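/- For every positive integer n there exists a convex polyhedron P inscribed in the unit sphere S² in ℝ³ (a Kitrick polyhedron) with exactly 60n² faces, all of which are triangles, such that η(P) = 2·sin(36°)·cos(c/(2n)), where c = arccos(cot(36°)/√3) (36° = π/5). Moreover the longest edges of P are the bases, and the shortest edges the equal legs, of certain isosceles triangular faces adjacent to the vertices of valence 5. In particular e_{60n²} ≤ 2·sin(36°)·cos(c/(2n)) < 2·sin(36°). -/

import Mathlib

open scoped Real
open Filter

noncomputable section

abbrev E3 := EuclideanSpace ℝ (Fin 3)

/-- `F` is a face of dimension `d` of the convex body `P`: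
a nonempty convex extreme subset whose affine hull has dimension `d`. -/
def IsFaceDim (P F : Set E3) (d : ℕ) : Prop :=
  F.Nonempty ∧ Convex ℝ F ∧ IsExtreme ℝ P F ∧ Module.finrank ℝ (vectorSpan ℝ F) = d

/-- A convex polyhedron inscribed in the unit sphere `S²` in `ℝ³`, given as the convex hull
of a finite vertex set `V ⊆ S²` each point of which is an extreme point of the hull,
which is three-dimensional, all of whose 2-dimensional faces are triangles,
and which has exactly `m` faces (2-dimensional faces). -/
structure InscribedTriPoly (m : ℕ) where
  V : Finset E3
  on_sphere : ∀ v ∈ V, ‖v‖ = 1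
  is_vertex : ∀ v ∈ V, v ∈ Set.extremePoints ℝ (convexHull ℝ (V : Set E3))
  full_dim : affineSpan ℝ (V : Set E3) = ⊤
  faces_triangles : ∀ F : Set E3, IsFaceDim (convexHull ℝ (V : Set E3)) F 2 →
      ∃ a b c : E3, a ∈ V ∧ b ∈ V ∧ c ∈ V ∧ AffineIndependent ℝ ![a, b, c] ∧
        F = convexHull ℝ ({a, b, c} : Set E3)
  card_faces : {F : Set E3 | IsFaceDim (convexHull ℝ (V : Set E3)) F 2}.ncard = m

/-- The set of lengths of the edges (1-dimensional faces) of the polytope `conv V`. -/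
def edgeLengths (V : Finset E3) : Set ℝ :=
  {d : ℝ | ∃ p q : E3, p ≠ q ∧ IsFaceDim (convexHull ℝ (V : Set E3)) (segment ℝ p q) 1 ∧
    d = dist p q}

/-- `η` : quotient of the longest edge length by the shortest edge length. -/
def eta (V : Finset E3) : ℝ := sSup (edgeLengths V) / sInf (edgeLengths V)

/-- `e m` : the infimum of `η P` over all convex polyhedra `P` inscribed in the unit
sphere with exactly `m` faces, all triangles. -/
def e (m : ℕ) : ℝ := sInf {x : ℝ | ∃ P : InscribedTriPoly m, x = eta P.V}

open scoped RealInnerProductSpace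

/-! ### The cross product and the triple product on `E3` -/

theorem inner_coords (x y : E3) : ⟪x, y⟫ = x 0 * y 0 + x 1 * y 1 + x 2 * y 2 := by
  simp [PiLp.inner_apply, Fin.sum_univ_three, mul_comm]

/-- The cross product on `E3`. -/
def cross (x y : E3) : E3 :=
  !₂[x 1 * y 2 - x 2 * y 1, x 2 * y 0 - x 0 * y 2, x 0 * y 1 - x 1 * y 0]

/-- The triple product on `E3`, that is, the signed volume of the parallelepiped. -/
def vol (x y z : E3) : ℝ := ⟪cross x y, z⟫

@[simp] theorem cross_zero_apply (x y : E3) : cross x y 0 = x 1 * y 2 - x 2 * y 1 := rfl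
@[simp] theorem cross_one_apply (x y : E3) : cross x y 1 = x 2 * y 0 - x 0 * y 2 := rfl
@[simp] theorem cross_two_apply (x y : E3) : cross x y 2 = x 0 * y 1 - x 1 * y 0 := rfl

theorem E3.ext {x y : E3} (h0 : x 0 = y 0) (h1 : x 1 = y 1) (h2 : x 2 = y 2) : x = y := by
  ext i
  fin_cases i <;> assumption

theorem vol_rotate (a b c : E3) : vol b c a = vol a b c := by
  simp only [vol, inner_coords, cross_zero_apply, cross_one_apply, cross_two_apply]
  ring

theorem vol_smul_eq (a b c x : E3) :
    vol a b c • x = vol b c x • a + vol c a x • b + vol a b x • c := by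
  apply E3.ext <;>
    simp only [vol, inner_coords, cross_zero_apply, cross_one_apply, cross_two_apply,
      PiLp.smul_apply, PiLp.add_apply, smul_eq_mul] <;> ring

/-- The vector `ν` with `⟪ν, x⟫ = 1` on the plane through `a`, `b`, `c`. -/
def planeNormal (a b c : E3) : E3 :=
  (vol a b c)⁻¹ • (cross a b + cross b c + cross c a)

theorem planeNormal_rotate (a b c : E3) : planeNormal b c a = planeNormal a b c := by
  unfold planeNormal
  rw [vol_rotate]
  congr 1
  abel

theorem inner_planeNormal {a b c : E3} (h : vol a b c ≠ 0) : ⟪planeNormal a b c, a⟫ = 1 := by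
  have : ⟪planeNormal a b c, a⟫ = (vol a b c)⁻¹ * vol a b c := by
    simp only [planeNormal, vol, inner_coords, cross_zero_apply, cross_one_apply, cross_two_apply,
      PiLp.smul_apply, PiLp.add_apply, smul_eq_mul]
    ring
  rw [this, inv_mul_cancel₀ h]

/-- If `a`, `b`, `c` are unit vectors and the triangle `abc` has an acute angle at `c`, then its
circumcentre lies on the same side of the plane through `0`, `a`, `b` as `c`. -/
theorem inner_planeNormal_cross_pos {a b c : E3} (ha : ‖a‖ = 1) (hb : ‖b‖ = 1)
    (h : 0 < vol a b c) (hab : ⟪a, b⟫ < 1) (hc : ⟪c, a⟫ + ⟪c, b⟫ < 1 + ⟪a, b⟫) :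
    0 < ⟪planeNormal a b c, cross a b⟫ := by
  have ha' : ⟪a, a⟫ = 1 := by rw [real_inner_self_eq_norm_sq, ha, one_pow]
  have hb' : ⟪b, b⟫ = 1 := by rw [real_inner_self_eq_norm_sq, hb, one_pow]
  have key : ⟪planeNormal a b c, cross a b⟫ = (vol a b c)⁻¹ *
      (⟪a, a⟫ * ⟪b, b⟫ - ⟪a, b⟫ ^ 2 + (⟪c, b⟫ * ⟪a, b⟫ - ⟪c, a⟫ * ⟪b, b⟫) +
        (⟪c, a⟫ * ⟪a, b⟫ - ⟪c, b⟫ * ⟪a, a⟫)) := by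
    rw [planeNormal, real_inner_smul_left]
    simp only [inner_coords, cross_zero_apply, cross_one_apply, cross_two_apply, PiLp.add_apply]
    ring
  rw [key, ha', hb']
  have : 0 < (1 - ⟪a, b⟫) * (1 + ⟪a, b⟫ - ⟪c, a⟫ - ⟪c, b⟫) :=
    mul_pos (by linarith) (by linarith)
  apply mul_pos (inv_pos.2 h)
  linarith

/-- Local convexity along an edge `ab` shared by two acute triangles inscribed in the unit
sphere: the triangle with the larger supporting functional lies on the side of `x`. -/
theorem vol_nonneg_of_inner_planeNormal_le {a b p q x : E3} (ha : ‖a‖ = 1) (hb : ‖b‖ = 1)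
    (hp : 0 < vol a b p) (hq : 0 < vol b a q) (hab : ⟪a, b⟫ < 1)
    (hpa : ⟪p, a⟫ + ⟪p, b⟫ < 1 + ⟪a, b⟫) (hqa : ⟪q, b⟫ + ⟪q, a⟫ < 1 + ⟪b, a⟫)
    (hx : ⟪planeNormal b a q, x⟫ ≤ ⟪planeNormal a b p, x⟫) : 0 ≤ vol a b x := by
  have h1 := inner_planeNormal_cross_pos ha hb hp hab hpa
  have h2 := inner_planeNormal_cross_pos hb ha hq (by rwa [real_inner_comm]) hqa
  have a1 : ⟪planeNormal a b p, a⟫ = 1 := inner_planeNormal hp.ne'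
  have a2 : ⟪planeNormal b a q, b⟫ = 1 := inner_planeNormal hq.ne'
  have b1 : ⟪planeNormal a b p, b⟫ = 1 := by
    rw [← planeNormal_rotate]; exact inner_planeNormal (by rw [vol_rotate]; exact hp.ne')
  have b2 : ⟪planeNormal b a q, a⟫ = 1 := by
    rw [← planeNormal_rotate]; exact inner_planeNormal (by rw [vol_rotate]; exact hq.ne')
  set m := planeNormal a b p - planeNormal b a q with hm
  have ma : ⟪m, a⟫ = 0 := by rw [hm, inner_sub_left, a1, b2, sub_self]
  have mb : ⟪m, b⟫ = 0 := by rw [hm, inner_sub_left, b1, a2, sub_self]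
  have mx : 0 ≤ ⟪m, x⟫ := by rw [hm, inner_sub_left]; linarith
  have hswap : cross b a = -cross a b := by
    apply E3.ext <;> simp [mul_comm]
  have mc : 0 < ⟪m, cross a b⟫ := by
    rw [hswap, inner_neg_right] at h2
    rw [hm, inner_sub_left]; linarith
  have key : ⟪m, x⟫ * ⟪cross a b, cross a b⟫ = ⟪m, cross a b⟫ * vol a b x +
      ⟪m, a⟫ * vol b (cross a b) x + ⟪m, b⟫ * vol (cross a b) a x := by
    have := congrArg (fun y ↦ ⟪m, y⟫) (vol_smul_eq a b (cross a b) x)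
    simp only [inner_add_right, real_inner_smul_right] at this
    rw [show vol a b (cross a b) = ⟪cross a b, cross a b⟫ from rfl] at this
    linarith
  rw [ma, mb] at key
  have : 0 ≤ ⟪m, cross a b⟫ * vol a b x := by
    have := mul_nonneg mx (real_inner_self_nonneg (x := cross a b))
    linarith
  exact nonneg_of_mul_nonneg_right this mc

/-! ### Acute triangulations of the unit sphere -/

/-- A finite family of positively oriented triangles inscribed in the unit sphere, all of them
acute, which is closed under passing to the neighbour across an edge, and such that no vertex
lies in the cone over a triangle unless it is a vertex of that triangle. -/
structure AcuteTriangulation (ι : Type) where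
  vert : ι → Fin 3 → E3
  norm_vert : ∀ s k, ‖vert s k‖ = 1
  vol_pos : ∀ s, 0 < vol (vert s 0) (vert s 1) (vert s 2)
  acute : ∀ s k, ⟪vert s k, vert s (k + 1)⟫ + ⟪vert s k, vert s (k + 2)⟫ <
    1 + ⟪vert s (k + 1), vert s (k + 2)⟫
  adj : ∀ s k, ∃ s' k', vert s' (k' + 1) = vert s (k + 2) ∧ vert s' (k' + 2) = vert s (k + 1)
  sep : ∀ s s' k (w : Fin 3 → ℝ), (∀ l, 0 ≤ w l) → vert s' k = ∑ l, w l • vert s l →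
    ∃ l, vert s' k = vert s l

namespace AcuteTriangulation

variable {ι : Type} (T : AcuteTriangulation ι)

theorem vol_pos' (s : ι) (k : Fin 3) :
    0 < vol (T.vert s (k + 1)) (T.vert s (k + 2)) (T.vert s k) := by
  have h := T.vol_pos s
  fin_cases k
  · exact (vol_rotate _ _ _).symm ▸ h
  · exact (vol_rotate _ _ _) ▸ h
  · exact h

/-- The outer normal of the plane of a triangle, scaled to have value `1` on the triangle. -/
def normal (s : ι) : E3 := planeNormal (T.vert s 0) (T.vert s 1) (T.vert s 2)

theorem normal_eq (s : ι) (k : Fin 3) :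
    T.normal s = planeNormal (T.vert s (k + 1)) (T.vert s (k + 2)) (T.vert s k) := by
  fin_cases k
  · exact (planeNormal_rotate _ _ _).symm
  · exact planeNormal_rotate _ _ _
  · rfl

theorem inner_normal_vert (s : ι) (k : Fin 3) : ⟪T.normal s, T.vert s k⟫ = 1 := by
  rw [T.normal_eq s k, ← planeNormal_rotate, ← planeNormal_rotate]
  exact inner_planeNormal (by rw [vol_rotate, vol_rotate]; exact (T.vol_pos' s k).ne')

theorem vert_injective (s : ι) : Function.Injective (T.vert s) := by
  have h : ∀ k, T.vert s (k + 1) ≠ T.vert s (k + 2) := fun k hk ↦ by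
    have := T.vol_pos' s k
    rw [hk] at this
    simp only [vol, inner_coords, cross_zero_apply, cross_one_apply, cross_two_apply] at this
    ring_nf at this
    exact lt_irrefl _ this
  have h0 := h 0
  have h1 := h 1
  have h2 := h 2
  intro k l hkl
  fin_cases k <;> fin_cases l <;> simp_all

theorem inner_vert_lt_one (s : ι) {k l : Fin 3} (h : k ≠ l) : ⟪T.vert s k, T.vert s l⟫ < 1 :=
  (inner_lt_one_iff_real_of_norm_eq_one (T.norm_vert s k) (T.norm_vert s l)).2
    fun e ↦ h (T.vert_injective s e)

theorem vol_nonneg_of_max {s : ι} {x : E3} (h : ∀ s', ⟪T.normal s', x⟫ ≤ ⟪T.normal s, x⟫)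
    (k : Fin 3) : 0 ≤ vol (T.vert s (k + 1)) (T.vert s (k + 2)) x := by
  obtain ⟨s', k', h1, h2⟩ := T.adj s k
  have hx := h s'
  have hv := T.vol_pos' s' k'
  have hac := T.acute s' k'
  rw [T.normal_eq s k, T.normal_eq s' k', h1, h2] at hx
  rw [h1, h2] at hv hac
  exact vol_nonneg_of_inner_planeNormal_le (T.norm_vert _ _) (T.norm_vert _ _) (T.vol_pos' s k) hv
    (T.inner_vert_lt_one s (by fin_cases k <;> decide)) (T.acute s k) hac hx

theorem exists_max [Finite ι] [Nonempty ι] (x : E3) :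
    ∃ s, ∀ s', ⟪T.normal s', x⟫ ≤ ⟪T.normal s, x⟫ :=
  Finite.exists_max fun s ↦ ⟪T.normal s, x⟫

/-- A triangle whose supporting functional is maximal at `x` contains `x` in its cone. -/
theorem exists_weights_of_max {s : ι} {x : E3} (h : ∀ s', ⟪T.normal s', x⟫ ≤ ⟪T.normal s, x⟫) :
    ∃ w : Fin 3 → ℝ, (∀ l, 0 ≤ w l) ∧ x = ∑ l, w l • T.vert s l ∧ ∑ l, w l = ⟪T.normal s, x⟫ := by
  have hv := T.vol_pos s
  set V := vol (T.vert s 0) (T.vert s 1) (T.vert s 2)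
  have hx : x = ∑ l, (V⁻¹ * vol (T.vert s (l + 1)) (T.vert s (l + 2)) x) • T.vert s l := by
    simp only [mul_smul, ← Finset.smul_sum]
    rw [eq_inv_smul_iff₀ hv.ne', Fin.sum_univ_three]
    exact vol_smul_eq _ _ _ _
  refine ⟨_, fun l ↦ mul_nonneg (inv_nonneg.2 hv.le) (T.vol_nonneg_of_max h l), hx, ?_⟩
  conv_rhs => rw [hx]
  simp only [inner_sum, real_inner_smul_right, T.inner_normal_vert, mul_one]

section Hull

variable [Fintype ι]

/-- The set of all vertices of the triangles. -/
def verts : Finset E3 :=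
  haveI := Classical.decEq E3
  Finset.univ.image fun p : ι × Fin 3 ↦ T.vert p.1 p.2

theorem mem_verts {v : E3} : v ∈ T.verts ↔ ∃ s k, T.vert s k = v := by
  simp [verts]

/-- The polytope spanned by the vertices. -/
def hull : Set E3 := convexHull ℝ (T.verts : Set E3)

theorem vert_mem_verts (s : ι) (k : Fin 3) : T.vert s k ∈ T.verts := T.mem_verts.2 ⟨s, k, rfl⟩

theorem vert_mem_hull (s : ι) (k : Fin 3) : T.vert s k ∈ T.hull :=
  subset_convexHull ℝ _ (T.vert_mem_verts s k)

theorem norm_of_mem_verts {v : E3} (hv : v ∈ T.verts) : ‖v‖ = 1 := by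
  obtain ⟨s, k, rfl⟩ := T.mem_verts.1 hv
  exact T.norm_vert s k

theorem convex_hull : Convex ℝ T.hull := convex_convexHull _ _

theorem eq_vert_of_max {v : E3} (hv : v ∈ T.verts) {s : ι}
    (h : ∀ s', ⟪T.normal s', v⟫ ≤ ⟪T.normal s, v⟫) : ∃ l, v = T.vert s l := by
  obtain ⟨s', k, rfl⟩ := T.mem_verts.1 hv
  obtain ⟨w, hw, hx, -⟩ := T.exists_weights_of_max h
  exact T.sep s s' k w hw hx

variable [Nonempty ι]

theorem inner_normal_le_one {v : E3} (hv : v ∈ T.verts) (s : ι) : ⟪T.normal s, v⟫ ≤ 1 := by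
  obtain ⟨s', h⟩ := T.exists_max v
  obtain ⟨l, rfl⟩ := T.eq_vert_of_max hv h
  exact T.inner_normal_vert s' l ▸ h s

theorem eq_vert_of_inner_normal_eq_one {v : E3} (hv : v ∈ T.verts) {s : ι}
    (h : ⟪T.normal s, v⟫ = 1) : ∃ l, v = T.vert s l :=
  T.eq_vert_of_max hv fun s' ↦ h.symm ▸ T.inner_normal_le_one hv s'

theorem inner_normal_le_one_of_mem_hull {x : E3} (hx : x ∈ T.hull) (s : ι) :
    ⟪T.normal s, x⟫ ≤ 1 := by
  have hc : Convex ℝ {x : E3 | ⟪T.normal s, x⟫ ≤ 1} :=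
    convex_halfSpace_le (innerSL ℝ (T.normal s)).toLinearMap.isLinear 1
  exact convexHull_min (fun v hv ↦ T.inner_normal_le_one hv s) hc hx

theorem zero_mem_hull : (0 : E3) ∈ T.hull := by
  obtain ⟨s₀⟩ := ‹Nonempty ι›
  obtain ⟨s, h⟩ := T.exists_max (-T.vert s₀ 0)
  obtain ⟨w, hw, hx, -⟩ := T.exists_weights_of_max h
  have hW : 0 ≤ ∑ l, w l := Finset.sum_nonneg fun l _ ↦ hw l
  have key : (1 + ∑ l, w l)⁻¹ • (T.vert s₀ 0 + ∑ l, w l • T.vert s l) ∈ T.hull := by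
    have := T.convex_hull.centerMass_mem (t := Finset.univ) (w := fun o : Option (Fin 3) ↦ o.elim 1 w)
      (z := fun o ↦ o.elim (T.vert s₀ 0) (T.vert s)) ?_ ?_ ?_
    · simpa [Finset.centerMass, Fintype.sum_option] using this
    · rintro (_ | l) -
      exacts [zero_le_one, hw l]
    · rw [Fintype.sum_option]
      exact add_pos_of_pos_of_nonneg one_pos hW
    · rintro (_ | l) -
      exacts [T.vert_mem_hull _ _, T.vert_mem_hull _ _]
  rwa [← hx, add_neg_cancel, smul_zero] at key

theorem mem_hull_of_forall_le {x : E3} (h : ∀ s, ⟪T.normal s, x⟫ ≤ 1) : x ∈ T.hull := by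
  obtain ⟨s, hs⟩ := T.exists_max x
  obtain ⟨w, hw, hx, hsum⟩ := T.exists_weights_of_max hs
  have := T.convex_hull.sum_mem (t := Finset.univ)
    (w := fun o : Option (Fin 3) ↦ o.elim (1 - ∑ l, w l) w)
    (z := fun o ↦ o.elim 0 (T.vert s)) ?_ ?_ ?_
  · simpa [Fintype.sum_option, ← hx] using this
  · rintro (_ | l) -
    exacts [sub_nonneg.2 (hsum ▸ h s), hw l]
  · simp [Fintype.sum_option]
  · rintro (_ | l) -
    exacts [T.zero_mem_hull, T.vert_mem_hull _ _]

end Hull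

end AcuteTriangulation

/-! ### Faces of the hull of an acute triangulation -/

theorem left_mem_extremePoints_segment (p q : E3) : p ∈ (segment ℝ p q).extremePoints ℝ := by
  rcases eq_or_ne p q with rfl | hpq
  · simp [segment_same]
  refine mem_extremePoints_iff_left.2 ⟨left_mem_segment ℝ p q, ?_⟩
  rw [segment_eq_image']
  rintro _ ⟨t, ht, rfl⟩ _ ⟨u, hu, rfl⟩ ⟨a, b, ha, hb, hab, h⟩
  have h' : (a * t + b * u) • (q - p) = 0 := by
    have e : a • (p + t • (q - p)) + b • (p + u • (q - p)) =
        (a + b) • p + (a * t + b * u) • (q - p) := by module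
    rw [e, hab, one_smul] at h
    exact add_eq_left.1 h
  have h0 : a * t + b * u = 0 := (smul_eq_zero.1 h').resolve_right (sub_ne_zero.2 hpq.symm)
  have : t = 0 := by
    have := mul_nonneg hb.le hu.1
    have := mul_nonneg ha.le ht.1
    have : a * t = 0 := by linarith
    exact (mul_eq_zero.1 this).resolve_left ha.ne'
  simp [this]

theorem vectorSpan_convexHull (s : Set E3) :
    vectorSpan ℝ (convexHull ℝ s) = vectorSpan ℝ s := by
  rw [← direction_affineSpan, affineSpan_convexHull, direction_affineSpan]

namespace AcuteTriangulation

variable {ι : Type} (T : AcuteTriangulation ι)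

/-- The vectors dual to the vertices of a triangle. -/
def dualVec (s : ι) (k : Fin 3) : E3 :=
  (vol (T.vert s 0) (T.vert s 1) (T.vert s 2))⁻¹ • cross (T.vert s (k + 1)) (T.vert s (k + 2))

theorem sum_inner_dualVec_smul (s : ι) (x : E3) :
    ∑ l, ⟪T.dualVec s l, x⟫ • T.vert s l = x := by
  simp only [dualVec, real_inner_smul_left, mul_smul, ← Finset.smul_sum]
  rw [inv_smul_eq_iff₀ (T.vol_pos s).ne', Fin.sum_univ_three]
  exact (vol_smul_eq _ _ _ _).symm

theorem inner_dualVec_vert (s : ι) (k l : Fin 3) :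
    ⟪T.dualVec s k, T.vert s l⟫ = if k = l then 1 else 0 := by
  rw [dualVec, real_inner_smul_left]
  split_ifs with h
  · subst h
    rw [show ⟪cross (T.vert s (k + 1)) (T.vert s (k + 2)), T.vert s k⟫ =
      vol (T.vert s 0) (T.vert s 1) (T.vert s 2) from ?_, inv_mul_cancel₀ (T.vol_pos s).ne']
    fin_cases k
    · exact vol_rotate _ _ _
    · exact (vol_rotate _ _ _).symm
    · rfl
  · have : l = k + 1 ∨ l = k + 2 := by revert k l; decide
    rcases this with rfl | rfl <;>
      simp only [inner_coords, cross_zero_apply, cross_one_apply, cross_two_apply] <;> ring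

theorem sum_inner_dualVec (s : ι) (x : E3) : ∑ l, ⟪T.dualVec s l, x⟫ = ⟪T.normal s, x⟫ := by
  conv_rhs => rw [← T.sum_inner_dualVec_smul s x]
  simp only [inner_sum, real_inner_smul_right, T.inner_normal_vert, mul_one]

theorem linearIndependent_vert (s : ι) : LinearIndependent ℝ (T.vert s) := by
  refine Fintype.linearIndependent_iff.2 fun g hg k ↦ ?_
  have := congrArg (fun y ↦ ⟪T.dualVec s k, y⟫) hg
  simpa [inner_sum, real_inner_smul_right, inner_dualVec_vert] using this

/-- The face of a triangle spanned by the vertices with labels in `K`. -/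
def face (s : ι) (K : Finset (Fin 3)) : Set E3 := convexHull ℝ (T.vert s '' K)

theorem face_univ (s : ι) :
    T.face s Finset.univ = convexHull ℝ {T.vert s 0, T.vert s 1, T.vert s 2} := by
  rw [face, Finset.coe_univ, Set.image_univ]
  congr 1
  ext x
  simp [Fin.exists_fin_succ, eq_comm]

theorem face_pair (s : ι) (k l : Fin 3) :
    T.face s {k, l} = segment ℝ (T.vert s k) (T.vert s l) := by
  rw [face, Finset.coe_pair, Set.image_pair, convexHull_pair]

theorem vert_mem_face {s : ι} {K : Finset (Fin 3)} {k : Fin 3} (hk : k ∈ K) :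
    T.vert s k ∈ T.face s K :=
  subset_convexHull ℝ _ (Set.mem_image_of_mem _ hk)

theorem finrank_face (s : ι) {K : Finset (Fin 3)} (hK : K.Nonempty) :
    Module.finrank ℝ (vectorSpan ℝ (T.face s K)) = K.card - 1 := by
  have := Classical.decEq E3
  rw [face, vectorSpan_convexHull, ← Finset.coe_image]
  apply (T.linearIndependent_vert s).affineIndependent.finrank_vectorSpan_image_finset
  have := hK.card_pos
  omega

section Hull

variable [Fintype ι]

theorem mem_extremePoints_hull {v : E3} (hv : v ∈ T.verts) : v ∈ T.hull.extremePoints ℝ := by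
  have hsub : T.hull ⊆ Metric.closedBall 0 1 :=
    convexHull_min (fun w hw ↦ by simp [T.norm_of_mem_verts hw]) (convex_closedBall _ _)
  refine inter_extremePoints_subset_extremePoints_of_subset hsub ⟨subset_convexHull ℝ _ hv, ?_⟩
  apply StrictConvexSpace.sphere_subset_extremePoints_closedBall _ one_ne_zero
  simp [T.norm_of_mem_verts hv]

theorem face_subset_hull (s : ι) (K : Finset (Fin 3)) : T.face s K ⊆ T.hull :=
  convexHull_mono (by rintro _ ⟨k, -, rfl⟩; exact T.vert_mem_verts s k)

theorem mem_verts_of_isFaceDim_segment {p q : E3} (h : IsFaceDim T.hull (segment ℝ p q) 1) :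
    p ∈ T.verts :=
  extremePoints_convexHull_subset
    (h.2.2.1.extremePoints_subset_extremePoints (left_mem_extremePoints_segment p q))

variable [Nonempty ι]

theorem affineSpan_verts : affineSpan ℝ (T.verts : Set E3) = ⊤ := by
  obtain ⟨s⟩ := ‹Nonempty ι›
  have h0 : (0 : E3) ∈ affineSpan ℝ (T.verts : Set E3) := convexHull_subset_affineSpan _ T.zero_mem_hull
  rw [← (affineSpan ℝ (T.verts : Set E3)).direction_eq_top_iff_of_nonempty ⟨0, h0⟩, eq_top_iff]
  have hspan := (T.linearIndependent_vert s).span_eq_top_of_card_eq_finrank (by simp)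
  rw [← hspan, Submodule.span_le]
  rintro _ ⟨k, rfl⟩
  simpa using AffineSubspace.vsub_mem_direction
    (subset_affineSpan ℝ _ (T.vert_mem_verts s k)) h0

theorem finrank_hull : Module.finrank ℝ (vectorSpan ℝ T.hull) = 3 := by
  rw [hull, vectorSpan_convexHull, ← direction_affineSpan, T.affineSpan_verts,
    AffineSubspace.direction_top, finrank_top, finrank_euclideanSpace_fin]

theorem inner_dualVec_nonneg {s : ι} {x : E3} (hx : x ∈ T.hull) (h : ⟪T.normal s, x⟫ = 1)
    (k : Fin 3) : 0 ≤ ⟪T.dualVec s k, x⟫ := by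
  rw [dualVec, real_inner_smul_left]
  exact mul_nonneg (inv_nonneg.2 (T.vol_pos s).le)
    (T.vol_nonneg_of_max (fun s' ↦ h.symm ▸ T.inner_normal_le_one_of_mem_hull hx s') k)

theorem mem_face_iff {s : ι} {K : Finset (Fin 3)} {x : E3} :
    x ∈ T.face s K ↔ x ∈ T.hull ∧ ⟪T.normal s, x⟫ = 1 ∧ ∀ k ∉ K, ⟪T.dualVec s k, x⟫ = 0 := by
  constructor
  · intro hx
    have hlin : ∀ (v : E3) (r : ℝ), Convex ℝ {x : E3 | ⟪v, x⟫ = r} := fun v r ↦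
      convex_hyperplane (innerSL ℝ v).toLinearMap.isLinear r
    refine ⟨T.face_subset_hull s K hx, ?_, fun k hk ↦ ?_⟩
    · refine convexHull_min ?_ (hlin (T.normal s) 1) hx
      rintro _ ⟨k, -, rfl⟩
      exact T.inner_normal_vert s k
    · refine convexHull_min ?_ (hlin (T.dualVec s k) 0) hx
      rintro _ ⟨l, hl, rfl⟩
      exact (T.inner_dualVec_vert s k l).trans (if_neg (ne_of_mem_of_not_mem hl hk).symm)
  · rintro ⟨hx, h1, h0⟩
    have hsum : ∑ k ∈ K, ⟪T.dualVec s k, x⟫ = 1 := by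
      rw [← h1, ← T.sum_inner_dualVec s x]
      exact Finset.sum_subset (Finset.subset_univ K) fun k _ hk ↦ h0 k hk
    have hrep : ∑ k ∈ K, ⟪T.dualVec s k, x⟫ • T.vert s k = x := by
      conv_rhs => rw [← T.sum_inner_dualVec_smul s x]
      exact Finset.sum_subset (Finset.subset_univ K) fun k _ hk ↦ by rw [h0 k hk, zero_smul]
    rw [← hrep]
    exact (convex_convexHull ℝ _).sum_mem (fun k _ ↦ T.inner_dualVec_nonneg hx h1 k) hsum
      fun k hk ↦ T.vert_mem_face hk

theorem isExtreme_face (s : ι) (K : Finset (Fin 3)) : IsExtreme ℝ T.hull (T.face s K) := by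
  refine ⟨T.face_subset_hull s K, ?_⟩
  rintro x hx y hy z hz ⟨a, b, ha, hb, hab, rfl⟩
  obtain ⟨-, h1, h0⟩ := T.mem_face_iff.1 hz
  have hx1 := T.inner_normal_le_one_of_mem_hull hx s
  have hy1 := T.inner_normal_le_one_of_mem_hull hy s
  simp only [inner_add_right, real_inner_smul_right] at h1 h0
  have ex : ⟪T.normal s, x⟫ = 1 := by
    refine hx1.antisymm (le_of_mul_le_mul_left ?_ ha)
    nlinarith [mul_le_mul_of_nonneg_left hy1 hb.le]
  have ey : ⟪T.normal s, y⟫ = 1 := by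
    refine hy1.antisymm (le_of_mul_le_mul_left ?_ hb)
    nlinarith [mul_le_mul_of_nonneg_left hx1 ha.le]
  refine T.mem_face_iff.2 ⟨hx, ex, fun k hk ↦ ?_⟩
  have := mul_nonneg ha.le (T.inner_dualVec_nonneg hx ex k)
  have := mul_nonneg hb.le (T.inner_dualVec_nonneg hy ey k)
  have : a * ⟪T.dualVec s k, x⟫ = 0 := by linarith [h0 k hk]
  exact (mul_eq_zero.1 this).resolve_left ha.ne'

/-- An extreme subset containing a point strictly below all supporting planes is everything. -/
theorem eq_hull_of_inner_lt_one {F : Set E3} (hF : IsExtreme ℝ T.hull F) {x : E3} (hx : x ∈ F)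
    (h : ∀ s, ⟪T.normal s, x⟫ < 1) : F = T.hull := by
  refine hF.subset.antisymm fun y hy ↦ ?_
  have hcont : Continuous fun t : ℝ ↦ x + t • (x - y) := by fun_prop
  have hev : ∀ᶠ t : ℝ in nhds 0, ∀ s, ⟪T.normal s, x + t • (x - y)⟫ < 1 := by
    rw [Filter.eventually_all]
    intro s
    have hc : Continuous fun t : ℝ ↦ ⟪T.normal s, x + t • (x - y)⟫ := continuous_const.inner hcont
    exact hc.continuousAt.eventually_lt continuousAt_const (by simpa using h s)
  obtain ⟨t, ht, hpos⟩ := ((hev.filter_mono nhdsWithin_le_nhds).and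
    (self_mem_nhdsWithin : Set.Ioi (0 : ℝ) ∈ nhdsWithin 0 (Set.Ioi 0))).exists
  have hpos : 0 < t := hpos
  have hz : x + t • (x - y) ∈ T.hull := T.mem_hull_of_forall_le fun s ↦ (ht s).le
  refine hF.left_mem_of_mem_openSegment hy hz hx ⟨t / (1 + t), 1 / (1 + t), by positivity,
    by positivity, by field_simp; ring, ?_⟩
  have : (1 + t) ≠ 0 := by positivity
  have e : (t / (1 + t)) • y + (1 / (1 + t)) • (x + t • (x - y)) =
      (t / (1 + t) - 1 / (1 + t) * t) • y + ((1 / (1 + t)) * (1 + t)) • x := by module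
  rw [e, one_div_mul_cancel this, one_smul, one_div_mul_eq_div, sub_self, zero_smul, zero_add]

/-- Every proper face lies in one of the planes of the triangles. -/
theorem exists_forall_inner_eq_one {F : Set E3} (hF : IsExtreme ℝ T.hull F) (hc : Convex ℝ F)
    (hne : F ≠ T.hull) : ∃ s, ∀ x ∈ F, ⟪T.normal s, x⟫ = 1 := by
  by_contra! hcon
  choose y hy hy1 using hcon
  have hlt : ∀ s, ⟪T.normal s, y s⟫ < 1 := fun s ↦
    (T.inner_normal_le_one_of_mem_hull (hF.subset (hy s)) s).lt_of_ne (hy1 s)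
  have hcard : (0 : ℝ) < Fintype.card ι := by exact_mod_cast Fintype.card_pos
  have hsum : ∑ _s : ι, ((Fintype.card ι : ℝ)⁻¹) = 1 := by
    simp [hcard.ne']
  refine hne (T.eq_hull_of_inner_lt_one hF (x := ∑ s, (Fintype.card ι : ℝ)⁻¹ • y s)
    (hc.sum_mem (fun _ _ ↦ by positivity) hsum fun s _ ↦ hy s) fun s ↦ ?_)
  rw [inner_sum, ← hsum]
  apply Finset.sum_lt_sum
  · intro s' _
    rw [real_inner_smul_right]
    exact mul_le_of_le_one_right (by positivity)
      (T.inner_normal_le_one_of_mem_hull (hF.subset (hy s')) s)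
  · refine ⟨s, Finset.mem_univ s, ?_⟩
    rw [real_inner_smul_right]
    exact mul_lt_of_lt_one_right (by positivity) (hlt s)

/-- Every proper face is spanned by vertices of one of the triangles. -/
theorem exists_eq_face {F : Set E3} (hF : IsExtreme ℝ T.hull F) (hc : Convex ℝ F)
    (hne : F ≠ T.hull) : ∃ s K, F = T.face s K := by
  obtain ⟨s, hs⟩ := T.exists_forall_inner_eq_one hF hc hne
  classical
  refine ⟨s, Finset.univ.filter fun k ↦ T.vert s k ∈ F, Set.Subset.antisymm (fun x hx ↦ ?_) ?_⟩
  · have hxh := hF.subset hx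
    refine T.mem_face_iff.2 ⟨hxh, hs x hx, fun k hk ↦ ?_⟩
    by_contra hne0
    have hpos : 0 < ⟪T.dualVec s k, x⟫ :=
      (T.inner_dualVec_nonneg hxh (hs x hx) k).lt_of_ne' hne0
    have hk : T.vert s k ∉ F := by simpa using hk
    have hxk : x ≠ T.vert s k := fun e ↦ hk (e ▸ hx)
    set c := ⟪T.dualVec s k, x⟫
    have hsum : c + ∑ l ∈ Finset.univ.erase k, ⟪T.dualVec s l, x⟫ = 1 := by
      rw [Finset.add_sum_erase _ (fun l ↦ ⟪T.dualVec s l, x⟫) (Finset.mem_univ k),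
        T.sum_inner_dualVec, hs x hx]
    have hrep : c • T.vert s k +
        ∑ l ∈ Finset.univ.erase k, ⟪T.dualVec s l, x⟫ • T.vert s l = x := by
      rw [Finset.add_sum_erase _ (fun l ↦ ⟪T.dualVec s l, x⟫ • T.vert s l) (Finset.mem_univ k),
        T.sum_inner_dualVec_smul]
    have hnn : ∀ l ∈ Finset.univ.erase k, 0 ≤ ⟪T.dualVec s l, x⟫ := fun l _ ↦
      T.inner_dualVec_nonneg hxh (hs x hx) l
    have hr := Finset.sum_nonneg hnn
    have hr0 : 0 < ∑ l ∈ Finset.univ.erase k, ⟪T.dualVec s l, x⟫ := by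
      refine hr.lt_of_ne' fun h0 ↦ hxk ?_
      have hz := (Finset.sum_eq_zero_iff_of_nonneg hnn).1 h0
      rw [Finset.sum_eq_zero (s := Finset.univ.erase k)
        (fun l hl ↦ by rw [hz l hl, zero_smul])] at hrep
      rw [h0, add_zero] at hsum
      rw [← hrep, hsum, one_smul, add_zero]
    refine hk (hF.left_mem_of_mem_openSegment (T.vert_mem_hull s k)
      (T.convex_hull.centerMass_mem hnn hr0 fun l _ ↦ T.vert_mem_hull s l) hx
      ⟨c, _, hpos, hr0, hsum, ?_⟩)
    rw [Finset.centerMass, smul_inv_smul₀ hr0.ne', hrep]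
  · refine convexHull_min ?_ hc
    rintro _ ⟨k, hk, rfl⟩
    simpa using hk

theorem isFaceDim_face (s : ι) {K : Finset (Fin 3)} (hK : K.Nonempty) :
    IsFaceDim T.hull (T.face s K) (K.card - 1) :=
  ⟨(hK.to_set.image (T.vert s)).convexHull, convex_convexHull _ _, T.isExtreme_face s K,
    T.finrank_face s hK⟩

theorem exists_eq_face_of_isFaceDim {F : Set E3} {d : ℕ} (h : IsFaceDim T.hull F d) (hd : d < 3) :
    ∃ s K, F = T.face s K ∧ K.card = d + 1 := by
  obtain ⟨hn, hc, hF, hr⟩ := h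
  obtain ⟨s, K, rfl⟩ := T.exists_eq_face hF hc fun e ↦ by
    rw [e, T.finrank_hull] at hr
    omega
  have hK : K.Nonempty := by
    rw [Finset.nonempty_iff_ne_empty]
    rintro rfl
    simp [face] at hn
  refine ⟨s, K, rfl, ?_⟩
  rw [T.finrank_face s hK] at hr
  have := hK.card_pos
  omega

theorem isFaceDim_two_iff {F : Set E3} : IsFaceDim T.hull F 2 ↔ ∃ s, T.face s Finset.univ = F := by
  constructor
  · intro h
    obtain ⟨s, K, rfl, hK⟩ := T.exists_eq_face_of_isFaceDim h (by norm_num)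
    rw [(Finset.card_eq_iff_eq_univ K).1 (by simpa using hK)]
    exact ⟨s, rfl⟩
  · rintro ⟨s, rfl⟩
    exact T.isFaceDim_face s Finset.univ_nonempty

theorem isFaceDim_one_iff {p q : E3} : IsFaceDim T.hull (segment ℝ p q) 1 ↔
    ∃ s k l, k ≠ l ∧ T.vert s k = p ∧ T.vert s l = q := by
  constructor
  · intro h
    have hp := T.mem_verts_of_isFaceDim_segment h
    have hq := T.mem_verts_of_isFaceDim_segment (segment_symm ℝ p q ▸ h)
    obtain ⟨s, K, hK, -⟩ := T.exists_eq_face_of_isFaceDim h (by norm_num)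
    have hp1 := (T.mem_face_iff.1 (hK ▸ left_mem_segment ℝ p q)).2.1
    have hq1 := (T.mem_face_iff.1 (hK ▸ right_mem_segment ℝ p q)).2.1
    obtain ⟨k, rfl⟩ := T.eq_vert_of_inner_normal_eq_one hp hp1
    obtain ⟨l, rfl⟩ := T.eq_vert_of_inner_normal_eq_one hq hq1
    refine ⟨s, k, l, ?_, rfl, rfl⟩
    rintro rfl
    have := h.2.2.2
    rw [segment_same, vectorSpan_singleton] at this
    simp at this
  · rintro ⟨s, k, l, hkl, rfl, rfl⟩
    rw [← T.face_pair]
    have := T.isFaceDim_face s (K := {k, l}) ⟨k, by simp⟩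
    rwa [Finset.card_pair hkl] at this

/-- The hull of an acute triangulation whose triangles are pairwise different is an inscribed
polyhedron with the given triangles as faces. -/
def toPoly {m : ℕ} (hcard : Fintype.card ι = m)
    (hinj : ∀ s s', Set.range (T.vert s) = Set.range (T.vert s') → s = s') :
    InscribedTriPoly m where
  V := T.verts
  on_sphere _ hv := T.norm_of_mem_verts hv
  is_vertex _ hv := T.mem_extremePoints_hull hv
  full_dim := T.affineSpan_verts
  faces_triangles F hF := by
    obtain ⟨s, rfl⟩ := T.isFaceDim_two_iff.1 hF
    refine ⟨_, _, _, T.vert_mem_verts s 0, T.vert_mem_verts s 1, T.vert_mem_verts s 2, ?_,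
      T.face_univ s⟩
    have hv : ![T.vert s 0, T.vert s 1, T.vert s 2] = T.vert s := by
      ext k : 1
      fin_cases k <;> rfl
    rw [hv]
    exact (T.linearIndependent_vert s).affineIndependent
  card_faces := by
    have hrange : {F : Set E3 | IsFaceDim T.hull F 2} =
        Set.range fun s ↦ T.face s Finset.univ := by
      ext F
      exact T.isFaceDim_two_iff
    have hsub : ∀ s s', T.face s Finset.univ = T.face s' Finset.univ →
        Set.range (T.vert s) ⊆ Set.range (T.vert s') := by
      rintro s s' h _ ⟨k, rfl⟩
      have hk := (T.mem_face_iff.1 (h ▸ T.vert_mem_face (s := s) (Finset.mem_univ k))).2.1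
      obtain ⟨l, hl⟩ := T.eq_vert_of_inner_normal_eq_one (T.vert_mem_verts s k) hk
      exact ⟨l, hl.symm⟩
    have hf : Function.Injective fun s ↦ T.face s Finset.univ := fun s s' h ↦
      hinj s s' ((hsub s s' h).antisymm (hsub s' s h.symm))
    change {F : Set E3 | IsFaceDim T.hull F 2}.ncard = m
    rw [hrange, ← Set.image_univ, Set.ncard_image_of_injective _ hf, Set.ncard_univ,
      Nat.card_eq_fintype_card, hcard]

theorem mem_edgeLengths_iff {d : ℝ} :
    d ∈ edgeLengths T.verts ↔ ∃ s k l, k ≠ l ∧ d = dist (T.vert s k) (T.vert s l) := by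
  constructor
  · rintro ⟨p, q, -, h, rfl⟩
    obtain ⟨s, k, l, hkl, rfl, rfl⟩ := T.isFaceDim_one_iff.1 h
    exact ⟨s, k, l, hkl, rfl⟩
  · rintro ⟨s, k, l, hkl, rfl⟩
    exact ⟨_, _, (T.vert_injective s).ne hkl, T.isFaceDim_one_iff.2 ⟨s, k, l, hkl, rfl, rfl⟩, rfl⟩

end Hull

end AcuteTriangulation

/-! ### Orthonormal frames attached to two unit vectors with inner product `1 / √5` -/

/-- The inner product of two adjacent unit vertices of the regular icosahedron. -/
def icoCos : ℝ := 1 / √5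

theorem icoCos_pos : 0 < icoCos := by unfold icoCos; positivity

theorem icoCos_sq : icoCos ^ 2 = 1 / 5 := by
  rw [icoCos, div_pow, one_pow, Real.sq_sqrt (by norm_num)]

theorem icoCos_lt_half : icoCos < 1 / 2 := by
  nlinarith [icoCos_sq, icoCos_pos]

/-- The vector with coordinates `p, q, r` in the orthonormal frame whose first vector is `a`, and
whose second one points towards `b`, for unit vectors `a`, `b` with `⟪a, b⟫ = 1 / √5`. -/
def frame (a b : E3) (p q r : ℝ) : E3 :=
  p • a + (q / (2 * icoCos)) • (b - icoCos • a) + (r / (2 * icoCos)) • cross a b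

/-- Unit vectors at the distance of adjacent vertices of the icosahedron. -/
structure IcoPair (a b : E3) : Prop where
  left : ⟪a, a⟫ = 1
  right : ⟪b, b⟫ = 1
  inner : ⟪a, b⟫ = icoCos

theorem cross_swap (a b : E3) : cross b a = -cross a b := by
  apply E3.ext <;> simp [mul_comm]

theorem inner_cross_left (a b : E3) : ⟪a, cross a b⟫ = 0 := by
  simp only [inner_coords, cross_zero_apply, cross_one_apply, cross_two_apply]; ring

theorem inner_cross_right (a b : E3) : ⟪b, cross a b⟫ = 0 := by
  simp only [inner_coords, cross_zero_apply, cross_one_apply, cross_two_apply]; ring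

theorem inner_cross_cross (a b : E3) :
    ⟪cross a b, cross a b⟫ = ⟪a, a⟫ * ⟪b, b⟫ - ⟪a, b⟫ ^ 2 := by
  simp only [inner_coords, cross_zero_apply, cross_one_apply, cross_two_apply]; ring

theorem cross_cross_self (a b : E3) : cross a (cross a b) = ⟪a, b⟫ • a - ⟪a, a⟫ • b := by
  apply E3.ext <;>
    simp only [inner_coords, cross_zero_apply, cross_one_apply, cross_two_apply,
      PiLp.smul_apply, PiLp.sub_apply, smul_eq_mul] <;> ring

namespace IcoPair

variable {a b : E3} (h : IcoPair a b)
include h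

theorem symm : IcoPair b a := ⟨h.right, h.left, by rw [real_inner_comm, h.inner]⟩

theorem inner_cross_self : ⟪cross a b, cross a b⟫ = 4 * icoCos ^ 2 := by
  rw [inner_cross_cross, h.left, h.right, h.inner, icoCos_sq]; norm_num

theorem inner_frame (p q r p' q' r' : ℝ) :
    ⟪frame a b p q r, frame a b p' q' r'⟫ = p * p' + q * q' + r * r' := by
  have h0 := icoCos_pos.ne'
  have hba : ⟪b, a⟫ = icoCos := by rw [real_inner_comm, h.inner]
  have hca : ⟪cross a b, a⟫ = 0 := by rw [real_inner_comm, inner_cross_left]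
  have hcb : ⟪cross a b, b⟫ = 0 := by rw [real_inner_comm, inner_cross_right]
  simp only [frame, inner_add_left, inner_add_right, real_inner_smul_left, real_inner_smul_right,
    inner_sub_left, inner_sub_right, inner_cross_left, inner_cross_right, hca, hcb, h.left,
    h.right, h.inner, hba, h.inner_cross_self]
  field_simp
  linear_combination (-5 * q * q') * icoCos_sq

end IcoPair

theorem frame_pole (a b : E3) : frame a b 1 0 0 = a := by simp [frame]

theorem frame_target (a b : E3) : frame a b icoCos (2 * icoCos) 0 = b := by
  have h0 := icoCos_pos.ne'
  rw [frame, div_self (by positivity), zero_div]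
  module

theorem IcoPair.vol_frame {a b : E3} (h : IcoPair a b) (p q r p' q' r' p'' q'' r'' : ℝ) :
    vol (frame a b p q r) (frame a b p' q' r') (frame a b p'' q'' r'') =
      p * (q' * r'' - r' * q'') - q * (p' * r'' - r' * p'') + r * (p' * q'' - q' * p'') := by
  have h0 := icoCos_pos.ne'
  have hdet : ∀ (x y z : E3) (p q r p' q' r' p'' q'' r'' : ℝ),
      vol (p • x + q • y + r • z) (p' • x + q' • y + r' • z) (p'' • x + q'' • y + r'' • z) =
      (p * (q' * r'' - r' * q'') - q * (p' * r'' - r' * p'') + r * (p' * q'' - q' * p'')) *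
        vol x y z := by
    intros
    simp only [vol, inner_coords, cross_zero_apply, cross_one_apply, cross_two_apply,
      PiLp.smul_apply, PiLp.add_apply, smul_eq_mul]
    ring
  have hv : vol a (b - icoCos • a) (cross a b) = 4 * icoCos ^ 2 := by
    rw [← h.inner_cross_self]
    simp only [vol, inner_coords, cross_zero_apply, cross_one_apply, cross_two_apply,
      PiLp.smul_apply, PiLp.sub_apply, smul_eq_mul]
    ring
  simp only [frame]
  rw [hdet, hv]
  field_simp
  ring

/-- Turning the frame around its first vector. -/
theorem IcoPair.frame_rotate {a b : E3} (h : IcoPair a b) (c s p q r : ℝ) :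
    frame a (frame a b icoCos (2 * icoCos * c) (2 * icoCos * s)) p q r =
      frame a b p (q * c - r * s) (q * s + r * c) := by
  have h0 := icoCos_pos.ne'
  have e1 : frame a b icoCos (2 * icoCos * c) (2 * icoCos * s) =
      icoCos • a + c • (b - icoCos • a) + s • cross a b := by
    rw [frame, mul_div_cancel_left₀ _ (by positivity), mul_div_cancel_left₀ _ (by positivity)]
  have e2 : cross a (frame a b icoCos (2 * icoCos * c) (2 * icoCos * s)) =
      c • cross a b + s • cross a (cross a b) := by
    rw [e1]
    apply E3.ext <;>
      simp only [cross_zero_apply, cross_one_apply, cross_two_apply,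
        PiLp.smul_apply, PiLp.add_apply, PiLp.sub_apply, smul_eq_mul] <;> ring
  have e3 : cross a (cross a b) = -(b - icoCos • a) := by
    rw [cross_cross_self, h.left, h.inner]; module
  simp only [frame] at e1 ⊢
  simp only [frame] at e2
  rw [e2, e1, e3]
  module

/-- Exchanging the two vectors of a frame, for a vector on their perpendicular bisector. -/
theorem frame_symm (a b : E3) {p q : ℝ} (r : ℝ) (hpq : (1 - icoCos) * p = 2 * icoCos * q) :
    frame b a p q r = frame a b p q (-r) := by
  have h0 := icoCos_pos
  have h1 : p - q / 2 = q / (2 * icoCos) := by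
    have : (1 - icoCos) ≠ 0 := by linarith [icoCos_lt_half]
    field_simp
    apply mul_left_cancel₀ this
    linear_combination (2 * icoCos) * hpq + 5 * q * icoCos_sq
  have e : ∀ x y : E3, frame x y p q r =
      (p - q / 2) • x + (q / (2 * icoCos)) • y + (r / (2 * icoCos)) • cross x y := by
    intro x y
    have : q / 2 = q / (2 * icoCos) * icoCos := by field_simp
    rw [frame, this]
    module
  have e' : frame a b p q (-r) =
      (p - q / 2) • a + (q / (2 * icoCos)) • b - (r / (2 * icoCos)) • cross a b := by
    have : q / 2 = q / (2 * icoCos) * icoCos := by field_simp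
    rw [frame, this, neg_div]
    module
  rw [e, e', cross_swap, h1]
  module

/-! ### The regular icosahedron -/

/-- The vertices of the regular icosahedron when `g` is the golden ratio, on a sphere of squared
radius `2 + g`. The index `k + 6` belongs to the antipode of the vertex with index `k`. -/
def icoRaw (g : ℝ) : Fin 12 → E3 :=
  ![!₂[0, 1, g], !₂[0, 1, -g], !₂[g, 0, 1], !₂[-g, 0, 1], !₂[1, g, 0], !₂[1, -g, 0],
    !₂[0, -1, -g], !₂[0, -1, g], !₂[-g, 0, -1], !₂[g, 0, -1], !₂[-1, -g, 0], !₂[-1, g, 0]]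

/-- The neighbours of each vertex of the icosahedron in cyclic order. -/
def icoNbr : Fin 12 → Fin 5 → Fin 12 :=
  ![![2, 4, 11, 3, 7], ![4, 9, 6, 8, 11], ![0, 7, 5, 9, 4], ![0, 11, 8, 10, 7],
    ![0, 2, 9, 1, 11], ![2, 7, 10, 6, 9], ![1, 9, 5, 10, 8], ![0, 3, 10, 5, 2],
    ![1, 6, 10, 3, 11], ![1, 4, 2, 5, 6], ![3, 8, 6, 5, 7], ![0, 4, 1, 8, 3]]

/-- The position of a vertex among the neighbours of its neighbours. -/
def icoBack : Fin 12 → Fin 5 → Fin 5 :=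
  ![![0, 0, 0, 0, 0], ![3, 0, 0, 0, 2], ![0, 4, 0, 2, 1], ![3, 4, 3, 0, 1],
    ![1, 4, 1, 0, 1], ![2, 3, 3, 2, 3], ![2, 4, 3, 2, 1], ![4, 4, 4, 1, 1],
    ![3, 4, 1, 2, 3], ![1, 2, 3, 4, 1], ![3, 2, 3, 2, 2], ![2, 4, 4, 4, 1]]

/-- The unit vertices of the regular icosahedron. -/
def ico (k : Fin 12) : E3 := (√(2 + Real.goldenRatio))⁻¹ • icoRaw Real.goldenRatio k

section

variable {g : ℝ} (h : g ^ 2 = g + 1)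
include h

theorem icoRaw_inner_self (k : Fin 12) : ⟪icoRaw g k, icoRaw g k⟫ = 2 + g := by
  rw [inner_coords]
  fin_cases k <;> simp [icoRaw] <;> linarith

theorem icoRaw_inner_nbr (k : Fin 12) (r : Fin 5) :
    ⟪icoRaw g k, icoRaw g (icoNbr k r)⟫ = g := by
  rw [inner_coords]
  fin_cases k <;> fin_cases r <;> simp [icoRaw, icoNbr] <;> linarith

theorem icoRaw_nbr_succ (k : Fin 12) (r : Fin 5) :
    (2 : ℝ) • icoRaw g (icoNbr k (r + 1)) = (g - 1) •
      (icoRaw g k + icoRaw g (icoNbr k r)) + cross (icoRaw g k) (icoRaw g (icoNbr k r)) := by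
  fin_cases k <;> fin_cases r <;> apply E3.ext <;> simp [icoRaw, icoNbr] <;> ring_nf <;> linarith

end

theorem ico_antipode (k : Fin 12) : ico (k + 6) = -ico k := by
  have : icoRaw Real.goldenRatio (k + 6) = -icoRaw Real.goldenRatio k := by
    fin_cases k <;> apply E3.ext <;> simp [icoRaw]
  rw [ico, this, smul_neg, ico]

/-! ### Trigonometric constants -/

/-- `cos 36°` -/
def c5 : ℝ := Real.cos (π / 5)

/-- `sin 36°` -/
def s5 : ℝ := Real.sin (π / 5)

theorem c5_eq : c5 = (1 + √5) / 4 := by rw [c5, Real.cos_pi_div_five]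

theorem c5_pos : 0 < c5 := by rw [c5_eq]; positivity

theorem s5_pos : 0 < s5 := Real.sin_pos_of_pos_of_lt_pi (by positivity) (by linarith [Real.pi_pos])

theorem s5_sq_add_c5_sq : s5 ^ 2 + c5 ^ 2 = 1 := Real.sin_sq_add_cos_sq _

theorem sqrt_five_sq : √5 ^ 2 = (5 : ℝ) := Real.sq_sqrt (by norm_num)

theorem sqrt_five_mem : (2.236 : ℝ) < √5 ∧ √5 < 2.2361 := by
  constructor
  · exact Real.lt_sqrt_of_sq_lt (by norm_num)
  · rw [Real.sqrt_lt' (by norm_num)]; norm_num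

theorem icoCos_eq : icoCos = √5 / 5 := by
  rw [icoCos]
  field_simp
  linarith [sqrt_five_sq]

theorem c5_sq : 4 * c5 ^ 2 = 2 * c5 + 1 := by
  rw [c5_eq]; linear_combination sqrt_five_sq / 4

theorem s5_sq : s5 ^ 2 = (5 - √5) / 8 := by
  have := s5_sq_add_c5_sq
  rw [c5_eq] at this
  linear_combination this - sqrt_five_sq / 16

/-! ### Neighbours in the icosahedron in terms of frames -/

theorem goldenRatio_eq_two_mul_c5 : Real.goldenRatio = 2 * c5 := by
  rw [c5_eq, Real.goldenRatio]; ring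

theorem sqrt_two_add_goldenRatio : √(2 + Real.goldenRatio) = 4 * s5 * c5 := by
  rw [Real.sqrt_eq_iff_mul_self_eq_of_pos
    (mul_pos (mul_pos (by norm_num) s5_pos) c5_pos), goldenRatio_eq_two_mul_c5]
  linear_combination 16 * c5 ^ 2 * s5_sq_add_c5_sq + (2 - 4 * c5 ^ 2 - 2 * c5) * c5_sq

theorem icoPair_ico (k : Fin 12) (r : Fin 5) : IcoPair (ico k) (ico (icoNbr k r)) := by
  have hg := Real.goldenRatio_sq
  have hpos : 0 < 2 + Real.goldenRatio := by linarith [Real.goldenRatio_pos]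
  have hs : (√(2 + Real.goldenRatio))⁻¹ * (√(2 + Real.goldenRatio))⁻¹ =
      (2 + Real.goldenRatio)⁻¹ := by
    rw [← mul_inv, Real.mul_self_sqrt hpos.le]
  have hself : ∀ k, ⟪ico k, ico k⟫ = 1 := by
    intro k
    rw [ico, real_inner_smul_left, real_inner_smul_right, icoRaw_inner_self hg, ← mul_assoc, hs,
      inv_mul_cancel₀ hpos.ne']
  refine ⟨hself _, hself _, ?_⟩
  rw [ico, ico, real_inner_smul_left, real_inner_smul_right, icoRaw_inner_nbr hg, ← mul_assoc, hs,
    inv_mul_eq_div, div_eq_iff hpos.ne', goldenRatio_eq_two_mul_c5, c5_eq, icoCos_eq]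
  linear_combination -sqrt_five_sq / 10

theorem ico_nbr_succ (k : Fin 12) (r : Fin 5) :
    ico (icoNbr k (r + 1)) = frame (ico k) (ico (icoNbr k r)) icoCos
      (2 * icoCos * (c5 - 1 / 2)) (2 * icoCos * (2 * s5 * c5)) := by
  have h0 := icoCos_pos.ne'
  have hc := c5_pos.ne'
  have hs := s5_pos.ne'
  have h := icoRaw_nbr_succ Real.goldenRatio_sq k r
  have hcross : ∀ (x : ℝ) (a b : E3), cross (x • a) (x • b) = x ^ 2 • cross a b := by
    intro x a b
    apply E3.ext <;> simp only [cross_zero_apply, cross_one_apply, cross_two_apply,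
        PiLp.smul_apply, smul_eq_mul] <;> ring
  have hr : ∀ k, icoRaw Real.goldenRatio k = (4 * s5 * c5) • ico k := by
    intro k
    rw [ico, sqrt_two_add_goldenRatio, smul_smul, mul_inv_cancel₀ (by positivity), one_smul]
  simp only [hr, hcross] at h
  rw [frame, mul_div_cancel_left₀ _ (by positivity), mul_div_cancel_left₀ _ (by positivity)]
  have e : icoCos * (3 / 2 - c5) = c5 - 1 / 2 := by
    rw [icoCos_eq, c5_eq]; linear_combination -sqrt_five_sq / 20
  have h2 : (8 * s5 * c5) • ico (icoNbr k (r + 1)) = (8 * s5 * c5) • (icoCos • ico k +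
      (c5 - 1 / 2) • (ico (icoNbr k r) - icoCos • ico k) +
      (2 * s5 * c5) • cross (ico k) (ico (icoNbr k r))) := by
    have e' : (8 * s5 * c5) • (icoCos • ico k +
      (c5 - 1 / 2) • (ico (icoNbr k r) - icoCos • ico k) +
      (2 * s5 * c5) • cross (ico k) (ico (icoNbr k r))) = (8 * s5 * c5) •
      ((icoCos * (3 / 2 - c5)) • ico k +
      (c5 - 1 / 2) • ico (icoNbr k r) +
      (2 * s5 * c5) • cross (ico k) (ico (icoNbr k r))) := by module
    rw [e', e]
    rw [goldenRatio_eq_two_mul_c5] at h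
    calc _ = (2 : ℝ) • (4 * s5 * c5) • ico (icoNbr k (r + 1)) := by module
      _ = _ := by rw [h]; module
  exact smul_right_injective _ (show 8 * s5 * c5 ≠ 0 by positivity) h2

/-- The coordinates of the neighbours of `ico k`, in the frame given by one of them. -/
theorem ico_nbr_add (k : Fin 12) (r m : Fin 5) :
    ico (icoNbr k (r + m)) = frame (ico k) (ico (icoNbr k r)) icoCos
      (2 * icoCos * ![1, c5 - 1 / 2, -c5, -c5, c5 - 1 / 2] m)
      (2 * icoCos * ![0, 2 * s5 * c5, s5, -s5, -(2 * s5 * c5)] m) := by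
  have step : ∀ (m : Fin 5) (x y : ℝ), ico (icoNbr k (r + m)) =
      frame (ico k) (ico (icoNbr k r)) icoCos (2 * icoCos * x) (2 * icoCos * y) →
      ico (icoNbr k (r + (m + 1))) = frame (ico k) (ico (icoNbr k r)) icoCos
        (2 * icoCos * ((c5 - 1 / 2) * x - 2 * s5 * c5 * y))
        (2 * icoCos * ((c5 - 1 / 2) * y + 2 * s5 * c5 * x)) := by
    intro m x y h
    rw [← add_assoc, ico_nbr_succ, h, (icoPair_ico k r).frame_rotate]
    congr 1 <;> ring
  have hs := s5_sq_add_c5_sq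
  have h1 : ico (icoNbr k (r + 1)) = frame (ico k) (ico (icoNbr k r)) icoCos
      (2 * icoCos * (c5 - 1 / 2)) (2 * icoCos * (2 * s5 * c5)) := ico_nbr_succ k r
  have h2 : ico (icoNbr k (r + 2)) = frame (ico k) (ico (icoNbr k r)) icoCos
      (2 * icoCos * -c5) (2 * icoCos * s5) := by
    refine (step 1 _ _ h1).trans ?_
    congr 2
    · linear_combination -4 * c5 ^ 2 * hs + (c5 ^ 2 + c5 / 2 - 1 / 4) * c5_sq
    · linear_combination s5 * c5_sq
  have h3 : ico (icoNbr k (r + 3)) = frame (ico k) (ico (icoNbr k r)) icoCos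
      (2 * icoCos * -c5) (2 * icoCos * -s5) := by
    refine (step 2 _ _ h2).trans ?_
    congr 2
    · linear_combination -2 * c5 * hs + c5 / 2 * c5_sq
    · linear_combination -s5 / 2 * c5_sq
  have h4 : ico (icoNbr k (r + 4)) = frame (ico k) (ico (icoNbr k r)) icoCos
      (2 * icoCos * (c5 - 1 / 2)) (2 * icoCos * -(2 * s5 * c5)) := by
    refine (step 3 _ _ h3).trans ?_
    congr 2
    · linear_combination 2 * c5 * hs - (c5 / 2 + 1 / 2) * c5_sq
    · linear_combination -s5 / 2 * c5_sq
  fin_cases m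
  · simp [frame_target]
  exacts [h1, h2, h3, h4]

/-- The coordinates, in the frame of two adjacent vertices `a`, `b` of the icosahedron, of the
points whose nearest vertex is `a`, and whose second nearest vertex is `b`. -/
structure Wedge (p q r : ℝ) : Prop where
  pos : 0 < p
  side : |r| * c5 ≤ q * s5
  far : 2 * icoCos * q ≤ (1 - icoCos) * p

theorem ico_cases : ∀ (k : Fin 12) (r : Fin 5) (l : Fin 12), l = k ∨ l = k + 6 ∨
    ∃ m, l = icoNbr k (r + m) ∨ l = icoNbr k (r + m) + 6 := by
  decide +kernel

theorem inner_ico_frame (k : Fin 12) (r : Fin 5) (p q z : ℝ) :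
    ⟪ico k, frame (ico k) (ico (icoNbr k r)) p q z⟫ = p := by
  have := (icoPair_ico k r).inner_frame 1 0 0 p q z
  rw [frame_pole] at this
  rw [this]; ring

theorem inner_ico_nbr_frame (k : Fin 12) (r m : Fin 5) (p q z : ℝ) :
    ⟪ico (icoNbr k (r + m)), frame (ico k) (ico (icoNbr k r)) p q z⟫ = icoCos * p +
      2 * icoCos * (q * ![1, c5 - 1 / 2, -c5, -c5, c5 - 1 / 2] m +
        z * ![0, 2 * s5 * c5, s5, -s5, -(2 * s5 * c5)] m) := by
  rw [ico_nbr_add, (icoPair_ico k r).inner_frame]; ring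

namespace Wedge

variable {p q z : ℝ} (w : Wedge p q z)
include w

theorem q_nonneg : 0 ≤ q := by
  have := mul_nonneg (abs_nonneg z) c5_pos.le
  exact nonneg_of_mul_nonneg_left (this.trans w.side) s5_pos

theorem inner_le (k : Fin 12) (r : Fin 5) {l : Fin 12} (hl : l ≠ k) :
    ⟪ico l, frame (ico k) (ico (icoNbr k r)) p q z⟫ ≤
      ⟪ico (icoNbr k r), frame (ico k) (ico (icoNbr k r)) p q z⟫ ∧
    (0 < q → ⟪ico (icoNbr k r), frame (ico k) (ico (icoNbr k r)) p q z⟫ ≤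
        ⟪ico l, frame (ico k) (ico (icoNbr k r)) p q z⟫ →
      l = icoNbr k r ∨ (l = icoNbr k (r + 1) ∧ z * c5 = q * s5) ∨
        (l = icoNbr k (r + 4) ∧ -z * c5 = q * s5)) := by
  have ht := icoCos_pos
  have hs := s5_pos
  have hc := c5_pos
  have hc1 : 0.809 < c5 ∧ c5 < 0.80903 := by
    have := sqrt_five_mem
    rw [c5_eq]; constructor <;> linarith
  have hs1 : 0.58 < s5 ∧ s5 < 0.59 := by
    have := s5_sq_add_c5_sq
    constructor <;> nlinarith
  have hq := w.q_nonneg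
  have hz1 : z * c5 ≤ q * s5 := (mul_le_mul_of_nonneg_right (le_abs_self z) hc.le).trans w.side
  have hz2 : -z * c5 ≤ q * s5 := (mul_le_mul_of_nonneg_right (neg_le_abs z) hc.le).trans w.side
  have hz3 : |z| ≤ 0.73 * q := by
    have := w.side
    have := abs_nonneg z
    nlinarith
  rw [abs_le] at hz3
  have hp := w.pos
  have hpq : q ≤ 0.62 * p := by
    have h1 := icoCos_eq
    have h2 := sqrt_five_mem
    nlinarith [w.far]
  have h0 := inner_ico_nbr_frame k r 0 p q z
  simp only [add_zero, Matrix.cons_val_zero, mul_one, mul_zero] at h0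
  have hX : 3 / 2 - c5 = 2 * s5 ^ 2 := by
    linear_combination -2 * s5_sq_add_c5_sq + c5_sq / 2
  have hsz : -(0.45 * q) ≤ s5 * z ∧ s5 * z ≤ 0.45 * q := by constructor <;> nlinarith
  have hscz : |2 * s5 * c5 * z| ≤ 0.8 * q := by
    have := w.side
    rw [show 2 * s5 * c5 * z = (2 * s5) * (z * c5) by ring, abs_mul, abs_mul z, abs_of_pos hc,
      abs_of_pos (by positivity)]
    nlinarith
  rw [abs_le] at hscz
  have key : ∀ y : ℝ, icoCos * p + 2 * icoCos * y ≤ icoCos * p + 2 * icoCos * q ↔ y ≤ q := by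
    intro y
    rw [add_le_add_iff_left, mul_le_mul_iff_right₀ (by positivity)]
  have key' : ∀ y : ℝ, icoCos * p + 2 * icoCos * q ≤ icoCos * p + 2 * icoCos * y ↔ q ≤ y := by
    intro y
    rw [add_le_add_iff_left, mul_le_mul_iff_right₀ (by positivity)]
  have strict : ∀ {u v : ℝ} {P : Prop}, u < v → u ≤ v ∧ (0 < q → v ≤ u → P) :=
    fun h ↦ ⟨h.le, fun _ h' ↦ absurd h (not_lt.2 h')⟩
  rcases ico_cases k r l with rfl | rfl | ⟨m, rfl | rfl⟩
  · exact absurd rfl hl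
  · apply strict
    rw [ico_antipode, inner_neg_left, inner_ico_frame, h0]
    nlinarith
  · rw [inner_ico_nbr_frame, h0, key, key']
    fin_cases m
    · simp
    · change q * (c5 - 1 / 2) + z * (2 * s5 * c5) ≤ q ∧
        (0 < q → q ≤ q * (c5 - 1 / 2) + z * (2 * s5 * c5) → _)
      have e : q - (q * (c5 - 1 / 2) + z * (2 * s5 * c5)) = 2 * s5 * (q * s5 - z * c5) := by
        linear_combination q * hX
      refine ⟨?_, fun _ h ↦ Or.inr (Or.inl ⟨rfl, ?_⟩)⟩
      · rw [← sub_nonneg, e]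
        exact mul_nonneg (by positivity) (by linarith)
      · rw [← sub_nonpos, e] at h
        have := nonpos_of_mul_nonpos_right h (show 0 < 2 * s5 by positivity)
        linarith
    · change q * -c5 + z * s5 ≤ q ∧ (0 < q → q ≤ q * -c5 + z * s5 → _)
      exact ⟨by nlinarith, fun _ h ↦ by nlinarith⟩
    · change q * -c5 + z * -s5 ≤ q ∧ (0 < q → q ≤ q * -c5 + z * -s5 → _)
      exact ⟨by nlinarith, fun _ h ↦ by nlinarith⟩
    · change q * (c5 - 1 / 2) + z * -(2 * s5 * c5) ≤ q ∧
        (0 < q → q ≤ q * (c5 - 1 / 2) + z * -(2 * s5 * c5) → _)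
      have e : q - (q * (c5 - 1 / 2) + z * -(2 * s5 * c5)) = 2 * s5 * (q * s5 - -z * c5) := by
        linear_combination q * hX
      refine ⟨?_, fun _ h ↦ Or.inr (Or.inr ⟨rfl, ?_⟩)⟩
      · rw [← sub_nonneg, e]
        exact mul_nonneg (by positivity) (by linarith)
      · rw [← sub_nonpos, e] at h
        have := nonpos_of_mul_nonpos_right h (show 0 < 2 * s5 by positivity)
        linarith
  · apply strict
    rw [ico_antipode, inner_neg_left, inner_ico_nbr_frame, h0]
    suffices -p < q * (1 + ![1, c5 - 1 / 2, -c5, -c5, c5 - 1 / 2] m) +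
        z * ![0, 2 * s5 * c5, s5, -s5, -(2 * s5 * c5)] m by nlinarith
    fin_cases m <;> simp <;> nlinarith

end Wedge

/-! ### The angle `c` and the latitude and longitude functions -/

/-- The angular distance from a vertex of the icosahedron to an adjacent face centre. -/
def kitAngle : ℝ := Real.arccos (c5 / s5 / √3)

theorem cot_sq_lt : c5 ^ 2 < 3 * s5 ^ 2 := by
  rw [s5_sq, c5_eq]; nlinarith [sqrt_five_mem, sqrt_five_sq]

theorem cos_kitAngle_eq : Real.cos kitAngle = c5 / s5 / √3 := by
  have hc := c5_pos
  have hs := s5_pos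
  apply Real.cos_arccos
  · exact le_trans (by norm_num) (show 0 ≤ c5 / s5 / √3 by positivity)
  · rw [div_div, div_le_one (by positivity)]
    apply le_of_sq_le_sq _ (by positivity)
    rw [mul_pow, Real.sq_sqrt (by norm_num)]
    linarith [cot_sq_lt]

theorem s5_mul_cos_kitAngle : 3 * (s5 * Real.cos kitAngle) ^ 2 = c5 ^ 2 := by
  have hs := s5_pos.ne'
  rw [cos_kitAngle_eq, mul_pow, div_pow, div_pow, Real.sq_sqrt (by norm_num)]
  field_simp

theorem cos_kitAngle_pos : 0 < Real.cos kitAngle := by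
  have hc := c5_pos
  have hs := s5_pos
  rw [cos_kitAngle_eq]; positivity

theorem kitAngle_lt_pi_div_two : kitAngle < π / 2 := by
  rw [kitAngle, Real.arccos_lt_pi_div_two]
  have hc := c5_pos
  have hs := s5_pos
  positivity

theorem kitAngle_pos : 0 < kitAngle := by
  have hc := c5_pos
  have hs := s5_pos
  rw [kitAngle, Real.arccos_pos, div_div, div_lt_one (by positivity)]
  apply lt_of_pow_lt_pow_left₀ 2 (by positivity)
  rw [mul_pow, Real.sq_sqrt (by norm_num)]
  linarith [cot_sq_lt]

theorem cos_kitAngle_sq : Real.cos kitAngle ^ 2 = (5 + 2 * √5) / 15 := by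
  have h := s5_mul_cos_kitAngle
  rw [mul_pow, s5_sq] at h
  have h2 := sqrt_five_mem
  have : (5 - √5) ≠ 0 := by linarith
  apply mul_left_cancel₀ this
  rw [c5_eq] at h
  linear_combination 8 / 3 * h + 3 / 10 * sqrt_five_sq

theorem sin_kitAngle_sq : Real.sin kitAngle ^ 2 = (10 - 2 * √5) / 15 := by
  linear_combination Real.sin_sq_add_cos_sq kitAngle - cos_kitAngle_sq

theorem sin_kitAngle_pos : 0 < Real.sin kitAngle :=
  Real.sin_pos_of_pos_of_lt_pi kitAngle_pos (by linarith [kitAngle_lt_pi_div_two, Real.pi_pos])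

theorem kitAngle_far :
    2 * icoCos * (c5 * Real.sin kitAngle) = (1 - icoCos) * Real.cos kitAngle := by
  have h1 := sin_kitAngle_pos
  have h2 := cos_kitAngle_pos
  have h3 := icoCos_pos
  have h4 := icoCos_lt_half
  have h5 := c5_pos
  rw [← sq_eq_sq₀ (by positivity) (mul_nonneg (by linarith) h2.le)]
  simp only [mul_pow, sin_kitAngle_sq, cos_kitAngle_sq]
  rw [icoCos_eq, c5_eq]
  linear_combination (5 - √5) / 750 * (√5 ^ 2 + 2 * √5 + 10) * sqrt_five_sq

theorem kitAngle_le : kitAngle ≤ 0.66 := by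
  have h : Real.cos 0.66 < Real.cos kitAngle := by
    have h1 := Real.cos_bound (x := 0.66) (by rw [abs_of_pos] <;> norm_num)
    rw [abs_le, abs_of_pos (by norm_num)] at h1
    have h2 : Real.cos 0.66 ≤ 0.7922 := by norm_num at h1; linarith
    have h3 := cos_kitAngle_sq
    have h4 := cos_kitAngle_pos
    have h5 := sqrt_five_mem
    nlinarith
  by_contra! h'
  exact absurd (Real.cos_lt_cos_of_nonneg_of_le_pi (by norm_num)
    (by linarith [kitAngle_lt_pi_div_two, Real.pi_pos]) h') (not_lt.2 h.le)

/-- The latitude function of the rows, in terms of the distance from the pole. -/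
def lat (t : ℝ) : ℝ := Real.arcsin (s5 * Real.sin t)

/-- The longitude of the rows, in terms of the distance from the pole. -/
def lon (t : ℝ) : ℝ := Real.arctan (c5 * Real.tan t)

theorem s5_lt : s5 < 0.5878 ∧ 0.5877 < s5 := by
  have := s5_sq
  have := sqrt_five_mem
  have := s5_pos
  constructor <;> nlinarith

theorem abs_s5_mul_sin_lt (t : ℝ) : |s5 * Real.sin t| < 1 := by
  rw [abs_mul, abs_of_pos s5_pos]
  nlinarith [Real.abs_sin_le_one t, s5_lt, abs_nonneg (Real.sin t)]

theorem sin_lat (t : ℝ) : Real.sin (lat t) = s5 * Real.sin t := by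
  have := abs_lt.1 (abs_s5_mul_sin_lt t)
  exact Real.sin_arcsin this.1.le this.2.le

theorem cos_lat_pos (t : ℝ) : 0 < Real.cos (lat t) := by
  have := abs_lt.1 (abs_s5_mul_sin_lt t)
  exact Real.cos_pos_of_mem_Ioo ⟨Real.neg_pi_div_two_lt_arcsin.2 this.1,
    Real.arcsin_lt_pi_div_two.2 this.2⟩

theorem cos_lat_sq (t : ℝ) : Real.cos (lat t) ^ 2 = 1 - (s5 * Real.sin t) ^ 2 := by
  rw [← sin_lat]; exact Real.cos_sq' _

theorem cos_lon_pos (t : ℝ) : 0 < Real.cos (lon t) := Real.cos_arctan_pos _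

theorem cos_lon_mul_cos_lat {t : ℝ} (ht : 0 < Real.cos t) :
    Real.cos (lon t) * Real.cos (lat t) = Real.cos t := by
  rw [← sq_eq_sq₀ (mul_pos (cos_lon_pos t) (cos_lat_pos t)).le ht.le, mul_pow, cos_lat_sq, lon,
    Real.cos_sq_arctan, Real.tan_eq_sin_div_cos]
  have h1 : 0 < Real.cos t ^ 2 + c5 ^ 2 * Real.sin t ^ 2 := by positivity
  field_simp
  linear_combination -Real.sin t ^ 2 * s5_sq_add_c5_sq - Real.sin_sq_add_cos_sq t

theorem sin_lon_mul_cos_lat {t : ℝ} (ht : 0 < Real.cos t) :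
    Real.sin (lon t) * Real.cos (lat t) = c5 * Real.sin t := by
  have h : Real.sin (lon t) = c5 * Real.tan t * Real.cos (lon t) := by
    rw [← Real.tan_arctan (c5 * Real.tan t)]
    exact (Real.tan_mul_cos (cos_lon_pos t).ne').symm
  rw [h, mul_assoc, cos_lon_mul_cos_lat ht, mul_assoc, Real.tan_mul_cos ht.ne']

theorem hasDerivAt_lat (t : ℝ) :
    HasDerivAt lat (s5 * Real.cos t / Real.cos (lat t)) t := by
  have := abs_lt.1 (abs_s5_mul_sin_lt t)
  have h := (Real.hasDerivAt_arcsin this.1.ne' this.2.ne).comp t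
    ((Real.hasDerivAt_sin t).const_mul s5)
  have e : √(1 - (s5 * Real.sin t) ^ 2) = Real.cos (lat t) := by
    rw [← cos_lat_sq, Real.sqrt_sq (cos_lat_pos t).le]
  rw [e] at h
  exact h.congr_deriv (by ring)

theorem hasDerivAt_lon {t : ℝ} (ht : 0 < Real.cos t) :
    HasDerivAt lon (c5 / (1 - (s5 * Real.sin t) ^ 2)) t := by
  have h := ((Real.hasDerivAt_tan ht.ne').const_mul c5).arctan
  refine h.congr_deriv ?_
  rw [Real.tan_eq_sin_div_cos]
  have h1 : 0 < Real.cos t ^ 2 + c5 ^ 2 * Real.sin t ^ 2 := by positivity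
  have h2 : 1 - (s5 * Real.sin t) ^ 2 = Real.cos t ^ 2 + c5 ^ 2 * Real.sin t ^ 2 := by
    linear_combination -Real.sin t ^ 2 * s5_sq_add_c5_sq - Real.sin_sq_add_cos_sq t
  rw [h2]
  field_simp

theorem cos_pos_of_le {t : ℝ} (h0 : 0 ≤ t) (h1 : t ≤ kitAngle) : 0 < Real.cos t :=
  Real.cos_pos_of_mem_Ioo ⟨by linarith [Real.pi_pos], by linarith [kitAngle_lt_pi_div_two]⟩

theorem sin_le_sin_of_le {t t' : ℝ} (h0 : 0 ≤ t) (h : t ≤ t') (h1 : t' ≤ kitAngle) :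
    Real.sin t ≤ Real.sin t' :=
  Real.sin_le_sin_of_le_of_le_pi_div_two (by linarith [Real.pi_pos])
    (by linarith [kitAngle_lt_pi_div_two]) h

theorem sin_nonneg_of_le {t : ℝ} (h0 : 0 ≤ t) (h1 : t ≤ kitAngle) : 0 ≤ Real.sin t := by
  have := sin_le_sin_of_le le_rfl h0 h1
  rwa [Real.sin_zero] at this

theorem lat_deriv_anti {t t' : ℝ} (h0 : 0 ≤ t) (h : t ≤ t') (h1 : t' ≤ kitAngle) :
    s5 * Real.cos t' / Real.cos (lat t') ≤ s5 * Real.cos t / Real.cos (lat t) := by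
  have hs := s5_pos
  have c1 := cos_lat_pos t
  have c2 := cos_lat_pos t'
  have c3 := cos_pos_of_le h0 (h.trans h1)
  have c4 := cos_pos_of_le (h0.trans h) h1
  have h5 : Real.sin t ^ 2 ≤ Real.sin t' ^ 2 :=
    pow_le_pow_left₀ (sin_nonneg_of_le h0 (h.trans h1)) (sin_le_sin_of_le h0 h h1) 2
  rw [div_le_div_iff₀ c2 c1, mul_assoc, mul_assoc]
  apply mul_le_mul_of_nonneg_left _ hs.le
  rw [← sq_le_sq₀ (by positivity) (by positivity), mul_pow, mul_pow, cos_lat_sq, cos_lat_sq,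
    Real.cos_sq', Real.cos_sq']
  have h6 : 0 ≤ 1 - s5 ^ 2 := by linarith [s5_sq_add_c5_sq, sq_nonneg c5]
  linarith [mul_nonneg (sub_nonneg.2 h5) h6]

theorem lat_deriv_le {t : ℝ} (h0 : 0 ≤ t) (h1 : t ≤ kitAngle) :
    s5 * Real.cos t / Real.cos (lat t) ≤ s5 := by
  have := lat_deriv_anti le_rfl h0 h1
  simpa [lat] using this

theorem lat_deriv_kitAngle : s5 * Real.cos kitAngle / Real.cos (lat kitAngle) = 1 / 2 := by
  have hs := s5_pos
  have c1 := cos_lat_pos kitAngle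
  have c2 := cos_kitAngle_pos
  rw [div_eq_div_iff c1.ne' two_ne_zero, ← sq_eq_sq₀ (by positivity) (by positivity), mul_pow,
    one_mul, cos_lat_sq, mul_pow, mul_pow, sin_kitAngle_sq, cos_kitAngle_sq, s5_sq]
  linear_combination -1 / 20 * sqrt_five_sq

theorem lat_sub_mem {t t' : ℝ} (h0 : 0 ≤ t) (h : t ≤ t') (h1 : t' ≤ kitAngle) :
    1 / 2 * (t' - t) ≤ lat t' - lat t ∧ lat t' - lat t ≤ s5 * (t' - t) := by
  have hd : DifferentiableOn ℝ lat (interior (Set.Icc 0 kitAngle)) :=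
    fun x _ ↦ (hasDerivAt_lat x).differentiableAt.differentiableWithinAt
  have hc : ContinuousOn lat (Set.Icc 0 kitAngle) :=
    fun x _ ↦ (hasDerivAt_lat x).continuousAt.continuousWithinAt
  constructor
  · refine (convex_Icc 0 kitAngle).mul_sub_le_image_sub_of_le_deriv hc hd (fun x hx ↦ ?_) t
      ⟨h0, h.trans h1⟩ t' ⟨h0.trans h, h1⟩ h
    have := interior_subset hx
    rw [(hasDerivAt_lat x).deriv, ← lat_deriv_kitAngle]
    exact lat_deriv_anti this.1 this.2 le_rfl
  · refine (convex_Icc 0 kitAngle).image_sub_le_mul_sub_of_deriv_le hc hd (fun x hx ↦ ?_) t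
      ⟨h0, h.trans h1⟩ t' ⟨h0.trans h, h1⟩ h
    have := interior_subset hx
    rw [(hasDerivAt_lat x).deriv]
    exact lat_deriv_le this.1 this.2

theorem lat_zero : lat 0 = 0 := by simp [lat]

theorem lon_zero : lon 0 = 0 := by simp [lon]

theorem mul_lat_le {t t' : ℝ} (h0 : 0 ≤ t) (h : t ≤ t') (h1 : t' ≤ kitAngle) :
    t * lat t' ≤ t' * lat t := by
  have hd : DifferentiableOn ℝ lat (interior (Set.Icc 0 kitAngle)) :=
    fun x _ ↦ (hasDerivAt_lat x).differentiableAt.differentiableWithinAt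
  have hc : ContinuousOn lat (Set.Icc 0 kitAngle) :=
    fun x _ ↦ (hasDerivAt_lat x).continuousAt.continuousWithinAt
  have hconc : ConcaveOn ℝ (Set.Icc 0 kitAngle) lat := by
    refine AntitoneOn.concaveOn_of_deriv (convex_Icc 0 kitAngle) hc hd fun x hx y hy hxy ↦ ?_
    rw [(hasDerivAt_lat x).deriv, (hasDerivAt_lat y).deriv]
    exact lat_deriv_anti (interior_subset hx).1 hxy (interior_subset hy).2
  rcases (h0.trans h).eq_or_lt with h2 | h2
  · rw [← h2, lat_zero, le_antisymm (h2 ▸ h) h0]; simp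
  have := hconc.2 (show (0 : ℝ) ∈ _ from ⟨le_rfl, kitAngle_pos.le⟩) ⟨h2.le, h1⟩
    (show 0 ≤ 1 - t / t' by rw [sub_nonneg, div_le_one h2]; exact h)
    (show 0 ≤ t / t' by positivity) (by ring)
  rw [smul_zero, zero_add, lat_zero, smul_zero, zero_add, smul_eq_mul, smul_eq_mul,
    div_mul_cancel₀ _ h2.ne', div_mul_eq_mul_div, div_le_iff₀ h2] at this
  linarith

theorem lon_sub_le {t t' : ℝ} (h0 : 0 ≤ t) (h : t ≤ t') (h1 : t' ≤ kitAngle) :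
    lon t' - lon t ≤ 3 * (√5 - 1) / 4 * (t' - t) := by
  have hcos : ∀ x ∈ Set.Icc 0 kitAngle, 0 < Real.cos x := fun x hx ↦ cos_pos_of_le hx.1 hx.2
  refine (convex_Icc 0 kitAngle).image_sub_le_mul_sub_of_deriv_le
    (fun x hx ↦ (hasDerivAt_lon (hcos x hx)).continuousAt.continuousWithinAt)
    (fun x hx ↦ (hasDerivAt_lon
      (hcos x (interior_subset hx))).differentiableAt.differentiableWithinAt)
    (fun x hx ↦ ?_) t ⟨h0, h.trans h1⟩ t' ⟨h0.trans h, h1⟩ h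
  have hx := interior_subset hx
  have h5 : Real.sin x ^ 2 ≤ Real.sin kitAngle ^ 2 :=
    pow_le_pow_left₀ (sin_nonneg_of_le hx.1 hx.2) (sin_le_sin_of_le hx.1 hx.2 le_rfl) 2
  have h6 : (s5 * Real.sin x) ^ 2 ≤ (3 - √5) / 6 := by
    rw [mul_pow, s5_sq]
    rw [sin_kitAngle_sq] at h5
    have := sqrt_five_mem
    have := sqrt_five_sq
    nlinarith
  have h7 := sqrt_five_mem
  rw [(hasDerivAt_lon (hcos x hx)).deriv, div_le_iff₀ (by linarith), c5_eq]
  nlinarith [sqrt_five_sq]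

theorem lon_lt_lon {t t' : ℝ} (h0 : 0 ≤ t) (h : t < t') (h1 : t' ≤ kitAngle) :
    lon t < lon t' := by
  apply Real.arctan_strictMono
  refine mul_lt_mul_of_pos_left ?_ c5_pos
  exact Real.tan_lt_tan_of_lt_of_lt_pi_div_two (by linarith [Real.pi_pos])
    (by linarith [kitAngle_lt_pi_div_two]) h

theorem lon_lt_pi_div_two (t : ℝ) : lon t < π / 2 := Real.arctan_lt_pi_div_two _

theorem lat_lt_pi_div_two (t : ℝ) : lat t < π / 2 :=
  Real.arcsin_lt_pi_div_two.2 (abs_lt.1 (abs_s5_mul_sin_lt t)).2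

/-! ### Rows of the triangulation of a wedge -/

/-- The angular distance between the pole and the first row. -/
def rowGap (n : ℕ) : ℝ := kitAngle / n

/-- The distance from the pole to the ends of a row. -/
def rowAngle (n i : ℕ) : ℝ := i * rowGap n

/-- The longitude of a row. -/
def rowLon (n i : ℕ) : ℝ := lon (rowAngle n i)

/-- Half the latitude difference of neighbours in a row. -/
def rowStep (n i : ℕ) : ℝ := lat (rowAngle n i) / i

/-- The latitude of the points of a row. -/
def colLat (n i j : ℕ) : ℝ := rowStep n i * (2 * j - i)

/-- The inner product of two points of the triangulated wedge. -/
def gridInner (n i j i' j' : ℕ) : ℝ :=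
  Real.cos (colLat n i j) * Real.cos (colLat n i' j') * Real.cos (rowLon n i' - rowLon n i) +
    Real.sin (colLat n i j) * Real.sin (colLat n i' j')

theorem mul_rowStep (n i : ℕ) : i * rowStep n i = lat (rowAngle n i) := by
  rcases Nat.eq_zero_or_pos i with rfl | hi
  · simp [rowAngle, lat_zero]
  · rw [rowStep, mul_div_cancel₀]
    positivity

theorem rowAngle_succ (n i : ℕ) : rowAngle n (i + 1) = rowAngle n i + rowGap n := by
  simp [rowAngle, add_mul]

theorem rowStep_one (n : ℕ) : rowStep n 1 = lat (rowGap n) := by simp [rowStep, rowAngle]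

theorem gridInner_row (n i j : ℕ) : gridInner n i j i (j + 1) = Real.cos (2 * rowStep n i) := by
  rw [gridInner, sub_self, Real.cos_zero, mul_one, ← Real.cos_sub, ← Real.cos_neg]
  congr 1
  simp only [colLat]; push_cast; ring

theorem gridInner_eq (n i j i' j' : ℕ) : gridInner n i j i' j' =
    (1 + Real.cos (rowLon n i' - rowLon n i)) / 2 * Real.cos (colLat n i j - colLat n i' j') -
    (1 - Real.cos (rowLon n i' - rowLon n i)) / 2 * Real.cos (colLat n i j + colLat n i' j') := by
  rw [gridInner, Real.cos_sub (colLat n i j), Real.cos_add]; ring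

theorem gridInner_base (n j : ℕ) :
    gridInner n 1 j 1 (j + 1) = 1 - 2 * (s5 * Real.sin (rowGap n)) ^ 2 := by
  rw [gridInner_row, rowStep_one, Real.cos_two_mul, Real.cos_sq', sin_lat]
  ring

section

variable {n : ℕ} (hn : 0 < n)
include hn

theorem rowGap_pos : 0 < rowGap n := by
  have := kitAngle_pos
  rw [rowGap]; positivity

theorem rowGap_le : rowGap n ≤ 0.66 := by
  rw [rowGap]
  refine (div_le_self kitAngle_pos.le ?_).trans kitAngle_le
  exact_mod_cast hn

theorem rowGap_le_half (h : 2 ≤ n) : rowGap n ≤ 0.33 := by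
  rw [rowGap, div_le_iff₀ (by positivity)]
  have : (2 : ℝ) ≤ n := by exact_mod_cast h
  linarith [kitAngle_le]

theorem rowAngle_nonneg (i : ℕ) : 0 ≤ rowAngle n i :=
  mul_nonneg (Nat.cast_nonneg i) (rowGap_pos hn).le

theorem rowAngle_self : rowAngle n n = kitAngle := by
  rw [rowAngle, rowGap, mul_div_cancel₀]; positivity

theorem rowAngle_lt {i i' : ℕ} (h : i < i') : rowAngle n i < rowAngle n i' :=
  mul_lt_mul_of_pos_right (by exact_mod_cast h) (rowGap_pos hn)

theorem rowAngle_mono {i i' : ℕ} (h : i ≤ i') : rowAngle n i ≤ rowAngle n i' :=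
  mul_le_mul_of_nonneg_right (by exact_mod_cast h) (rowGap_pos hn).le

theorem rowAngle_le {i : ℕ} (h : i ≤ n) : rowAngle n i ≤ kitAngle :=
  (rowAngle_mono hn h).trans (rowAngle_self hn).le

theorem lat_rowAngle_succ_sub {i : ℕ} (h : i < n) :
    1 / 2 * rowGap n ≤ lat (rowAngle n (i + 1)) - lat (rowAngle n i) ∧
      lat (rowAngle n (i + 1)) - lat (rowAngle n i) ≤ s5 * rowGap n := by
  have := lat_sub_mem (rowAngle_nonneg hn i) (rowAngle_mono hn i.le_succ) (rowAngle_le hn h)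
  rwa [Nat.succ_eq_add_one, show rowAngle n (i + 1) - rowAngle n i = rowGap n by
    rw [rowAngle_succ, add_sub_cancel_left]] at this

theorem rowStep_mem {i : ℕ} (h0 : 0 < i) (h : i ≤ n) :
    1 / 2 * rowGap n ≤ rowStep n i ∧ rowStep n i ≤ s5 * rowGap n := by
  have := lat_sub_mem le_rfl (rowAngle_nonneg hn i) (rowAngle_le hn h)
  rw [lat_zero, sub_zero, sub_zero, ← mul_rowStep, rowAngle] at this
  have hi : (0 : ℝ) < i := by exact_mod_cast h0
  constructor
  · apply le_of_mul_le_mul_left _ hi; linarith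
  · apply le_of_mul_le_mul_left _ hi; linarith

theorem rowStep_pos {i : ℕ} (h0 : 0 < i) (h : i ≤ n) : 0 < rowStep n i :=
  lt_of_lt_of_le (mul_pos one_half_pos (rowGap_pos hn)) (rowStep_mem hn h0 h).1

theorem rowStep_anti {i i' : ℕ} (h0 : 0 < i) (h : i ≤ i') (h' : i' ≤ n) :
    rowStep n i' ≤ rowStep n i := by
  have := mul_lat_le (rowAngle_nonneg hn i) (rowAngle_mono hn h) (rowAngle_le hn h')
  rw [← mul_rowStep, ← mul_rowStep, rowAngle, rowAngle] at this
  have hi : (0 : ℝ) < i := by exact_mod_cast h0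
  have hi' : (0 : ℝ) < i' := by exact_mod_cast h0.trans_le h
  have hg := rowGap_pos hn
  apply le_of_mul_le_mul_left _ (show 0 < rowGap n * i * i' by positivity)
  linarith

theorem abs_colLat_le {i j : ℕ} (hij : j ≤ i) (h : i ≤ n) : |colLat n i j| ≤ lat (rowAngle n i) := by
  rcases Nat.eq_zero_or_pos i with rfl | hi
  · have : j = 0 := by omega
    subst this
    simp [colLat, rowAngle, lat_zero]
  · rw [colLat, abs_mul, abs_of_pos (rowStep_pos hn hi h), mul_comm, ← mul_rowStep]
    apply mul_le_mul_of_nonneg_right _ (rowStep_pos hn hi h).le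
    have : (j : ℝ) ≤ i := by exact_mod_cast hij
    rw [abs_le]
    constructor <;> linarith [Nat.cast_nonneg (α := ℝ) j]

theorem gridInner_left {i : ℕ} (h : i < n) : gridInner n i 0 (i + 1) 0 = Real.cos (rowGap n) := by
  have e : ∀ i, colLat n i 0 = -lat (rowAngle n i) := by
    intro i
    rw [← mul_rowStep, colLat]; push_cast; ring
  have c1 := cos_pos_of_le (rowAngle_nonneg hn i) (rowAngle_le hn h.le)
  have c2 := cos_pos_of_le (rowAngle_nonneg hn (i + 1)) (rowAngle_le hn h)
  have hg : rowGap n = rowAngle n (i + 1) - rowAngle n i := by rw [rowAngle_succ]; ring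
  rw [gridInner, hg, Real.cos_sub, Real.cos_sub, e, e, ← cos_lon_mul_cos_lat c1,
    ← cos_lon_mul_cos_lat c2, Real.sin_neg, Real.sin_neg, Real.cos_neg, Real.cos_neg, sin_lat,
    sin_lat, rowLon, rowLon]
  linear_combination (c5 * Real.sin (rowAngle n i)) * (sin_lon_mul_cos_lat c2) +
    Real.sin (lon (rowAngle n (i + 1))) * Real.cos (lat (rowAngle n (i + 1))) *
      (sin_lon_mul_cos_lat c1) +
    Real.sin (rowAngle n i) * Real.sin (rowAngle n (i + 1)) * s5_sq_add_c5_sq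

omit hn in
theorem gridInner_mirror (n : ℕ) {i j i' j' : ℕ} (h : j ≤ i) (h' : j' ≤ i') :
    gridInner n i (i - j) i' (i' - j') = gridInner n i j i' j' := by
  have e : ∀ {i j}, j ≤ i → colLat n i (i - j) = -colLat n i j := by
    intro i j h
    rw [colLat, colLat, Nat.cast_sub h]; ring
  rw [gridInner, gridInner, e h, e h']
  simp only [Real.cos_neg, Real.sin_neg, neg_mul_neg]

theorem lon_sub_mem {i : ℕ} (h : i < n) : 0 < rowLon n (i + 1) - rowLon n i ∧
    rowLon n (i + 1) - rowLon n i ≤ 3 * (√5 - 1) / 4 * rowGap n := by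
  have h1 := lon_sub_le (rowAngle_nonneg hn i) (rowAngle_mono hn i.le_succ) (rowAngle_le hn h)
  have h2 := lon_lt_lon (rowAngle_nonneg hn i) (rowAngle_lt hn i.lt_succ_self) (rowAngle_le hn h)
  rw [show rowAngle n (i.succ) - rowAngle n i = rowGap n by
    rw [Nat.succ_eq_add_one, rowAngle_succ, add_sub_cancel_left]] at h1
  exact ⟨sub_pos.2 h2, h1⟩

/-- The latitude difference along a slanted edge. -/
theorem colLat_sub_mem {i j : ℕ} (h : i < n) (hj : j ≤ i) :
    lat (rowAngle n (i + 1)) - lat (rowAngle n i) ≤ colLat n i j - colLat n (i + 1) j ∧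
    (0 < i → colLat n i j - colLat n (i + 1) j ≤ (2 * s5 - 1 / 2) * rowGap n) := by
  rcases Nat.eq_zero_or_pos i with rfl | hi
  · obtain rfl : j = 0 := by omega
    rw [← mul_rowStep, ← mul_rowStep, colLat, colLat]
    push_cast
    exact ⟨by linarith, fun h ↦ h.elim⟩
  · have h1 := rowStep_anti hn hi i.le_succ h
    have h2 := rowStep_mem hn i.succ_pos h
    have h3 := lat_rowAngle_succ_sub hn h
    rw [← mul_rowStep, ← mul_rowStep] at h3 ⊢
    have h4 : (j : ℝ) ≤ i := by exact_mod_cast hj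
    have h5 : (0 : ℝ) ≤ j := Nat.cast_nonneg j
    simp only [colLat, Nat.succ_eq_add_one] at *
    push_cast at *
    exact ⟨by nlinarith, fun _ ↦ by nlinarith⟩

theorem gridInner_slant_le {i j : ℕ} (h : i < n) (hj : j ≤ i) :
    gridInner n i j (i + 1) j ≤ Real.cos (rowGap n) := by
  rw [← gridInner_left hn h, gridInner_eq, gridInner_eq n i 0]
  have e : ∀ i, colLat n i 0 = -lat (rowAngle n i) := by
    intro i
    rw [← mul_rowStep, colLat]; push_cast; ring
  rw [e, e, ← Real.cos_neg (-lat _ + _)]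
  have h1 := colLat_sub_mem hn h hj
  have h2 := abs_colLat_le hn hj h.le
  have h3 := abs_colLat_le hn (hj.trans i.le_succ) h
  have h4 := lat_lt_pi_div_two (rowAngle n i)
  have h5 := lat_lt_pi_div_two (rowAngle n (i + 1))
  have h6 := lat_rowAngle_succ_sub hn h
  have h7 := rowGap_pos hn
  rw [abs_le] at h2 h3
  have c1 : Real.cos (colLat n i j - colLat n (i + 1) j) ≤
      Real.cos (-lat (rowAngle n i) - -lat (rowAngle n (i + 1))) :=
    Real.cos_le_cos_of_nonneg_of_le_pi (by linarith) (by linarith) (by linarith)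
  have c2 : Real.cos (-(-lat (rowAngle n i) + -lat (rowAngle n (i + 1)))) ≤
      Real.cos (colLat n i j + colLat n (i + 1) j) := by
    rw [← Real.cos_abs (colLat n i j + _)]
    refine Real.cos_le_cos_of_nonneg_of_le_pi (abs_nonneg _) (by linarith) ?_
    rw [abs_le]
    constructor <;> linarith
  have c3 := Real.cos_le_one (rowLon n (i + 1) - rowLon n i)
  have c4 := Real.neg_one_le_cos (rowLon n (i + 1) - rowLon n i)
  have := mul_le_mul_of_nonneg_left c1
    (show 0 ≤ (1 + Real.cos (rowLon n (i + 1) - rowLon n i)) / 2 by linarith)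
  have := mul_le_mul_of_nonneg_left c2
    (show 0 ≤ (1 - Real.cos (rowLon n (i + 1) - rowLon n i)) / 2 by linarith)
  linarith

theorem one_sub_cos_rowGap_le : 1 - Real.cos (rowGap n) ≤ 2 * (s5 * Real.sin (rowGap n)) ^ 2 := by
  have h1 := rowGap_pos hn
  have h2 := rowGap_le hn
  have h3 := s5_lt
  have h4 := Real.one_sub_sq_div_two_le_cos (x := rowGap n)
  have h5 : 0.78 ≤ Real.cos (rowGap n) := by nlinarith
  have h6 := Real.cos_le_one (rowGap n)
  have h7 : 1 ≤ 2 * s5 ^ 2 * (1 + Real.cos (rowGap n)) := by nlinarith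
  rw [mul_pow, Real.sin_sq]
  nlinarith

theorem long_lt_two_mul_short :
    2 * (s5 * Real.sin (rowGap n)) ^ 2 < 2 * (1 - Real.cos (rowGap n)) := by
  have h1 := rowGap_pos hn
  have h2 : Real.cos (rowGap n) < 1 := by
    rw [← Real.cos_zero]
    exact Real.cos_lt_cos_of_nonneg_of_le_pi le_rfl
      (by linarith [rowGap_le hn, Real.pi_gt_three]) h1
  have h3 := s5_lt
  have h4 : s5 ^ 2 * (1 + Real.cos (rowGap n)) < 1 := by nlinarith
  rw [mul_pow, Real.sin_sq]
  nlinarith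

theorem le_gridInner_slant {i j : ℕ} (h : i < n) (hj : j ≤ i) :
    1 - 2 * (s5 * Real.sin (rowGap n)) ^ 2 ≤ gridInner n i j (i + 1) j := by
  rcases Nat.eq_zero_or_pos i with rfl | hi
  · obtain rfl : j = 0 := by omega
    rw [gridInner_left hn h]
    linarith [one_sub_cos_rowGap_le hn]
  have h1 := colLat_sub_mem hn h hj
  have h2 := lon_sub_mem hn h
  have h3 := lat_rowAngle_succ_sub hn h
  have h4 := rowGap_pos hn
  have h5 := rowGap_le_half hn (by omega)
  have h6 := s5_lt
  have h7 := sqrt_five_mem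
  have hsin : 0.9815 * rowGap n ≤ Real.sin (rowGap n) := by
    have := Real.sin_bound (x := rowGap n) (by rw [abs_of_pos h4]; linarith)
    rw [abs_of_pos h4, abs_le] at this
    have e2 : rowGap n ^ 2 ≤ 0.1089 := by nlinarith
    have e4 : rowGap n ^ 4 ≤ 0.012 := by nlinarith [sq_nonneg (rowGap n)]
    nlinarith
  rw [gridInner_eq]
  generalize colLat n i j - colLat n (i + 1) j = D at *
  generalize rowLon n (i + 1) - rowLon n i = E at *
  generalize colLat n i j + colLat n (i + 1) j = F at *
  have b1 := h1.2 hi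
  have b2 : 0 ≤ D := by linarith
  have c1 := Real.one_sub_sq_div_two_le_cos (x := D)
  have c2 := Real.one_sub_sq_div_two_le_cos (x := E)
  have c3 := Real.cos_le_one D
  have c4 := Real.cos_le_one F
  have c5 := Real.cos_le_one E
  have d1 : D ≤ 0.6756 * rowGap n := by nlinarith
  have d2 : E ≤ 0.92708 * rowGap n := by nlinarith
  have d3 : 0.5768 * rowGap n ≤ s5 * Real.sin (rowGap n) := by nlinarith
  have f1 := pow_le_pow_left₀ b2 d1 2
  have f2 := pow_le_pow_left₀ h2.1.le d2 2
  have f3 := pow_le_pow_left₀ (by positivity) d3 2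
  have f4 := mul_nonneg (sub_nonneg.2 c5) (show 0 ≤ 2 - Real.cos D - Real.cos F by linarith)
  nlinarith

theorem gridInner_row_mem {i : ℕ} (h0 : 0 < i) (h : i ≤ n) (j : ℕ) :
    1 - 2 * (s5 * Real.sin (rowGap n)) ^ 2 ≤ gridInner n i j i (j + 1) ∧
      gridInner n i j i (j + 1) ≤ Real.cos (rowGap n) := by
  have h1 := rowStep_mem hn h0 h
  have h2 := rowStep_anti hn one_pos h0 h
  have h3 := rowGap_pos hn
  have h4 := rowGap_le hn
  have h5 := s5_lt
  have h6 := Real.pi_gt_three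
  rw [gridInner_row]
  constructor
  · rw [Real.cos_two_mul, Real.cos_sq', ← sin_lat, ← rowStep_one]
    have h7 : Real.sin (rowStep n i) ≤ Real.sin (rowStep n 1) :=
      Real.sin_le_sin_of_le_of_le_pi_div_two (by linarith)
        (by rw [rowStep_one]; exact (lat_lt_pi_div_two _).le) h2
    have h8 : 0 ≤ Real.sin (rowStep n i) :=
      Real.sin_nonneg_of_nonneg_of_le_pi (by linarith) (by nlinarith)
    nlinarith
  · exact Real.cos_le_cos_of_nonneg_of_le_pi h3.le (by nlinarith) (by linarith)

end

/-! ### The points of the polyhedron -/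

/-- An ordered pair of adjacent vertices of the icosahedron: a vertex together with the position
of a neighbour. -/
abbrev Dart := Fin 12 × Fin 5

namespace Dart

/-- The source of a dart. -/
def src (d : Dart) : E3 := ico d.1

/-- The target of a dart. -/
def tgt (d : Dart) : E3 := ico (icoNbr d.1 d.2)

/-- The next dart around the source. -/
def next (d : Dart) : Dart := (d.1, d.2 + 1)

/-- The previous dart around the source. -/
def prev (d : Dart) : Dart := (d.1, d.2 + 4)

/-- The reversed dart. -/
def rev (d : Dart) : Dart := (icoNbr d.1 d.2, icoBack d.1 d.2)

theorem next_prev : ∀ d : Dart, d.prev.next = d := by decide +kernel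

theorem icoNbr_rev : ∀ d : Dart, icoNbr d.rev.1 d.rev.2 = d.1 := by decide +kernel

theorem icoNbr_ne : ∀ d : Dart, icoNbr d.1 d.2 ≠ d.1 := by decide +kernel

theorem icoNbr_injective : ∀ (k : Fin 12) (r r' : Fin 5), icoNbr k r = icoNbr k r' → r = r' := by
  decide +kernel

theorem ext_of_src_tgt {d d' : Dart} (h : d.1 = d'.1)
    (h' : icoNbr d.1 d.2 = icoNbr d'.1 d'.2) : d = d' := by
  obtain ⟨k, r⟩ := d
  obtain ⟨k', r'⟩ := d'
  obtain rfl : k = k' := h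
  exact congrArg (Prod.mk k) (icoNbr_injective _ _ _ h')

theorem icoPair (d : Dart) : IcoPair d.src d.tgt := icoPair_ico _ _

end Dart

/-- The points of the triangulated wedge at a dart: `j` is the position in row `i`. -/
def gridPt (n : ℕ) (d : Dart) (i j : ℕ) : E3 :=
  frame d.src d.tgt (Real.cos (colLat n i j) * Real.cos (rowLon n i))
    (Real.cos (colLat n i j) * Real.sin (rowLon n i)) (Real.sin (colLat n i j))

theorem inner_gridPt (n : ℕ) (d : Dart) (i j i' j' : ℕ) :
    ⟪gridPt n d i j, gridPt n d i' j'⟫ = gridInner n i j i' j' := by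
  rw [gridPt, gridPt, d.icoPair.inner_frame, gridInner, Real.cos_sub]; ring

theorem norm_gridPt (n : ℕ) (d : Dart) (i j : ℕ) : ‖gridPt n d i j‖ = 1 := by
  have h : ⟪gridPt n d i j, gridPt n d i j⟫ = 1 := by
    rw [inner_gridPt, gridInner, sub_self, Real.cos_zero, mul_one, ← sq, ← sq,
      Real.cos_sq_add_sin_sq]
  rwa [real_inner_self_eq_norm_sq, pow_eq_one_iff_of_nonneg (norm_nonneg _) two_ne_zero] at h

theorem colLat_zero_zero (n : ℕ) : colLat n 0 0 = 0 := by simp [colLat]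

theorem rowLon_zero (n : ℕ) : rowLon n 0 = 0 := by simp [rowLon, rowAngle, lon_zero]

theorem colLat_self (n i : ℕ) : colLat n i i = lat (rowAngle n i) := by
  rw [← mul_rowStep, colLat]; ring

theorem colLat_zero (n i : ℕ) : colLat n i 0 = -lat (rowAngle n i) := by
  rw [← mul_rowStep, colLat]; push_cast; ring

theorem gridPt_zero (n : ℕ) (d : Dart) : gridPt n d 0 0 = d.src := by
  simp [gridPt, colLat_zero_zero, rowLon_zero, frame_pole]

section

variable {n : ℕ} (hn : 0 < n)
include hn

theorem gridPt_next (d : Dart) {i : ℕ} (h : i ≤ n) : gridPt n d.next i 0 = gridPt n d i i := by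
  have c := cos_pos_of_le (rowAngle_nonneg hn i) (rowAngle_le hn h)
  have e : gridPt n d.next i 0 = frame d.src (frame d.src d.tgt icoCos
      (2 * icoCos * (c5 - 1 / 2)) (2 * icoCos * (2 * s5 * c5)))
      (Real.cos (lat (rowAngle n i)) * Real.cos (rowLon n i))
      (Real.cos (lat (rowAngle n i)) * Real.sin (rowLon n i)) (-Real.sin (lat (rowAngle n i))) := by
    rw [gridPt, colLat_zero, Real.cos_neg, Real.sin_neg]
    congr 1
    exact ico_nbr_succ _ _
  have e2 : Real.cos (lat (rowAngle n i)) * Real.sin (lon (rowAngle n i)) =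
      c5 * Real.sin (rowAngle n i) := by rw [mul_comm, sin_lon_mul_cos_lat c]
  rw [e, d.icoPair.frame_rotate, gridPt, colLat_self, rowLon, e2, sin_lat]
  congr 1
  · linear_combination Real.sin (rowAngle n i) * (2 * c5 * s5_sq_add_c5_sq - c5 / 2 * c5_sq)
  · linear_combination Real.sin (rowAngle n i) * s5 / 2 * c5_sq

/-- The defect in the side condition of a wedge at a point of a row, which vanishes at the end of
the row. -/
theorem cos_mul_sub_sin_mul {i : ℕ} (h : i ≤ n) (ψ : ℝ) :
    (Real.cos ψ * Real.sin (rowLon n i) * s5 - Real.sin ψ * c5) * Real.cos (lat (rowAngle n i)) =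
      c5 * Real.sin (lat (rowAngle n i) - ψ) := by
  have c := cos_pos_of_le (rowAngle_nonneg hn i) (rowAngle_le hn h)
  have e2 := sin_lon_mul_cos_lat c
  rw [Real.sin_sub, sin_lat, rowLon]
  linear_combination Real.cos ψ * s5 * e2

theorem far_eq {i : ℕ} (h : i ≤ n) : ((1 - icoCos) * Real.cos (rowLon n i) -
    2 * icoCos * Real.sin (rowLon n i)) * Real.cos (lat (rowAngle n i)) =
      (1 - icoCos) * Real.cos (rowAngle n i) - 2 * icoCos * (c5 * Real.sin (rowAngle n i)) := by
  have c := cos_pos_of_le (rowAngle_nonneg hn i) (rowAngle_le hn h)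
  rw [rowLon]
  linear_combination (1 - icoCos) * cos_lon_mul_cos_lat c - 2 * icoCos * sin_lon_mul_cos_lat c

theorem far_self : (1 - icoCos) * Real.cos (rowLon n n) = 2 * icoCos * Real.sin (rowLon n n) := by
  have := far_eq hn le_rfl
  rw [rowAngle_self hn, kitAngle_far, sub_self] at this
  linarith [(mul_eq_zero.1 this).resolve_right (cos_lat_pos _).ne']

theorem far_lt {i : ℕ} (h : i < n) :
    2 * icoCos * Real.sin (rowLon n i) < (1 - icoCos) * Real.cos (rowLon n i) := by
  have h1 := rowAngle_nonneg hn i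
  have h2 := rowAngle_lt hn h
  have h3 := far_eq hn h.le
  have h4 := kitAngle_far
  rw [rowAngle_self hn] at h2
  have h5 : Real.cos kitAngle < Real.cos (rowAngle n i) :=
    Real.cos_lt_cos_of_nonneg_of_le_pi h1 (by linarith [kitAngle_lt_pi_div_two, Real.pi_pos]) h2
  have h6 := sin_le_sin_of_le h1 h2.le le_rfl
  have h7 := mul_le_mul_of_nonneg_left h6 (mul_pos icoCos_pos c5_pos).le
  have h8 := mul_lt_mul_of_pos_left h5 (show 0 < 1 - icoCos by linarith [icoCos_lt_half])
  rw [← sub_pos]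
  refine (mul_pos_iff_of_pos_right (cos_lat_pos (rowAngle n i))).1 ?_
  rw [h3]
  linarith

theorem gridPt_rev (d : Dart) {j : ℕ} (h : j ≤ n) : gridPt n d.rev n j = gridPt n d n (n - j) := by
  have hsrc : d.rev.tgt = d.src := congrArg ico (Dart.icoNbr_rev d)
  have e : colLat n n (n - j) = -colLat n n j := by
    rw [colLat, colLat, Nat.cast_sub h]; ring
  rw [gridPt, hsrc, show d.rev.src = d.tgt from rfl, frame_symm, gridPt, e, Real.cos_neg,
    Real.sin_neg]
  linear_combination Real.cos (colLat n n j) * far_self hn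

theorem cos_colLat_pos {i j : ℕ} (hij : j ≤ i) (h : i ≤ n) : 0 < Real.cos (colLat n i j) := by
  have h1 := abs_le.1 (abs_colLat_le hn hij h)
  have h2 := lat_lt_pi_div_two (rowAngle n i)
  exact Real.cos_pos_of_mem_Ioo ⟨by linarith, by linarith⟩

theorem sin_rowLon_pos {i : ℕ} (h0 : 0 < i) (h : i ≤ n) : 0 < Real.sin (rowLon n i) := by
  apply Real.sin_pos_of_pos_of_lt_pi
  · have := lon_lt_lon (rowAngle_nonneg hn 0) (rowAngle_lt hn h0) (rowAngle_le hn h)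
    rwa [← rowLon, rowLon_zero] at this
  · linarith [lon_lt_pi_div_two (rowAngle n i), Real.pi_pos, rowLon.eq_def n i]

theorem wedge_gridPt {i j : ℕ} (hij : j ≤ i) (h : i ≤ n) :
    Wedge (Real.cos (colLat n i j) * Real.cos (rowLon n i))
      (Real.cos (colLat n i j) * Real.sin (rowLon n i)) (Real.sin (colLat n i j)) := by
  have h1 := abs_le.1 (abs_colLat_le hn hij h)
  have h2 := lat_lt_pi_div_two (rowAngle n i)
  have h3 := cos_colLat_pos hn hij h
  have h4 := cos_lat_pos (rowAngle n i)
  have side : ∀ ψ, |ψ| ≤ lat (rowAngle n i) →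
      Real.sin ψ * c5 ≤ Real.cos ψ * Real.sin (rowLon n i) * s5 := by
    intro ψ hψ
    rw [abs_le] at hψ
    rw [← sub_nonneg]
    apply nonneg_of_mul_nonneg_left _ h4
    rw [cos_mul_sub_sin_mul hn h]
    exact mul_nonneg c5_pos.le (Real.sin_nonneg_of_nonneg_of_le_pi (by linarith) (by linarith))
  refine ⟨mul_pos h3 (cos_lon_pos _), ?_, ?_⟩
  · rcases abs_choice (Real.sin (colLat n i j)) with e | e
    · rw [e]; exact side _ (abs_colLat_le hn hij h)
    · rw [e, ← Real.sin_neg, ← Real.cos_neg]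
      exact side _ ((abs_neg _).trans_le (abs_colLat_le hn hij h))
  · have : 2 * icoCos * Real.sin (rowLon n i) ≤ (1 - icoCos) * Real.cos (rowLon n i) := by
      rcases h.eq_or_lt with rfl | h'
      · exact (far_self hn).ge
      · exact (far_lt hn h').le
    nlinarith

/-- The only points of a row on the boundary of the wedge are its ends. -/
theorem eq_of_side_eq {i j : ℕ} (h0 : 0 < i) (hij : j ≤ i) (h : i ≤ n)
    (hs : Real.sin (colLat n i j) * c5 = Real.cos (colLat n i j) * Real.sin (rowLon n i) * s5) :
    j = i := by
  have h1 := abs_le.1 (abs_colLat_le hn hij h)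
  have h2 := lat_lt_pi_div_two (rowAngle n i)
  have h3 := cos_mul_sub_sin_mul hn h (colLat n i j)
  rw [← hs, sub_self, zero_mul, eq_comm, mul_eq_zero, or_iff_right c5_pos.ne',
    Real.sin_eq_zero_iff_of_lt_of_lt (by linarith [Real.pi_pos]) (by linarith), ← mul_rowStep,
    colLat] at h3
  have h4 : rowStep n i * (i - j) = 0 := by linarith
  have h5 := (mul_eq_zero.1 h4).resolve_left (rowStep_pos hn h0 h).ne'
  have h6 : (i : ℝ) = j := by linarith
  exact_mod_cast h6.symm

theorem eq_zero_of_side_eq {i j : ℕ} (h0 : 0 < i) (hij : j ≤ i) (h : i ≤ n)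
    (hs : -Real.sin (colLat n i j) * c5 = Real.cos (colLat n i j) * Real.sin (rowLon n i) * s5) :
    j = 0 := by
  have e : colLat n i (i - j) = -colLat n i j := by
    rw [colLat, colLat, Nat.cast_sub hij]; ring
  have := eq_of_side_eq hn h0 (Nat.sub_le i j) h (by rw [e, Real.sin_neg, Real.cos_neg, hs])
  omega

end

/-- The points whose nearest and second nearest vertices of the icosahedron are the source and
the target of a dart. -/
def Dart.InWedge (d : Dart) (x : E3) : Prop :=
  ∃ p q z, Wedge p q z ∧ frame d.src d.tgt p q z = x

namespace Dart.InWedge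

variable {d : Dart} {x : E3} (h : d.InWedge x)
include h

theorem inner_le_tgt {l : Fin 12} (hl : l ≠ d.1) : ⟪ico l, x⟫ ≤ ⟪d.tgt, x⟫ := by
  obtain ⟨p, q, z, w, rfl⟩ := h
  exact (w.inner_le d.1 d.2 hl).1

theorem inner_tgt_le_src : ⟪d.tgt, x⟫ ≤ ⟪d.src, x⟫ := by
  obtain ⟨p, q, z, w, rfl⟩ := h
  have h1 := inner_ico_nbr_frame d.1 d.2 0 p q z
  have h2 := inner_ico_frame d.1 d.2 p q z
  simp only [add_zero, Matrix.cons_val_zero, mul_one, mul_zero] at h1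
  rw [src, tgt, h1, h2]
  linarith [w.far]

end Dart.InWedge

section

variable {n : ℕ} (hn : 0 < n)
include hn

theorem inWedge_gridPt (d : Dart) {i j : ℕ} (hij : j ≤ i) (h : i ≤ n) :
    d.InWedge (gridPt n d i j) :=
  ⟨_, _, _, wedge_gridPt hn hij h, rfl⟩

theorem gridPt_prev (d : Dart) {i : ℕ} (h : i ≤ n) : gridPt n d.prev i i = gridPt n d i 0 := by
  rw [← gridPt_next hn _ h, Dart.next_prev]

theorem inner_tgt_lt_src (d : Dart) {i j : ℕ} (hij : j ≤ i) (h : i < n) :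
    ⟪d.tgt, gridPt n d i j⟫ < ⟪d.src, gridPt n d i j⟫ := by
  have h1 := inner_ico_nbr_frame d.1 d.2 0
  have h2 := inner_ico_frame d.1 d.2
  simp only [add_zero, Matrix.cons_val_zero, mul_one, mul_zero] at h1
  have := far_lt hn h
  have := cos_colLat_pos hn hij h.le
  rw [gridPt, Dart.src, Dart.tgt, h1, h2]
  nlinarith

/-- The neighbour which is the second nearest vertex of the icosahedron is unique up to ties at
the ends of the rows. -/
theorem icoNbr_cases (d : Dart) {i j : ℕ} (h0 : 0 < i) (hij : j ≤ i) (h : i ≤ n) {l : Fin 12}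
    (hl : l ≠ d.1) (hle : ⟪d.tgt, gridPt n d i j⟫ ≤ ⟪ico l, gridPt n d i j⟫) :
    l = icoNbr d.1 d.2 ∨ (l = icoNbr d.next.1 d.next.2 ∧ j = i) ∨
      (l = icoNbr d.prev.1 d.prev.2 ∧ j = 0) := by
  have w := wedge_gridPt hn hij h
  have hq := mul_pos (cos_colLat_pos hn hij h) (sin_rowLon_pos hn h0 h)
  rcases (w.inner_le d.1 d.2 hl).2 hq hle with e | ⟨e, e'⟩ | ⟨e, e'⟩
  · exact Or.inl e
  · exact Or.inr (Or.inl ⟨e, eq_of_side_eq hn h0 hij h e'⟩)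
  · exact Or.inr (Or.inr ⟨e, eq_zero_of_side_eq hn h0 hij h e'⟩)

theorem exists_gridPt_eq_of_src_eq {d d' : Dart} (hd : d.1 = d'.1) {i j : ℕ} (hij : j ≤ i)
    (h : i ≤ n) (hw : d.InWedge (gridPt n d' i j)) :
    ∃ i' j', j' ≤ i' ∧ i' ≤ n ∧ gridPt n d' i j = gridPt n d i' j' := by
  rcases Nat.eq_zero_or_pos i with rfl | h0
  · obtain rfl : j = 0 := by omega
    exact ⟨0, 0, le_rfl, h, by rw [gridPt_zero, gridPt_zero, Dart.src, Dart.src, hd]⟩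
  have h1 := hw.inner_le_tgt (l := icoNbr d'.1 d'.2) (hd ▸ Dart.icoNbr_ne d')
  rcases icoNbr_cases hn d' h0 hij h (l := icoNbr d.1 d.2) (hd ▸ Dart.icoNbr_ne d) h1 with
    e | ⟨e, rfl⟩ | ⟨e, rfl⟩
  · obtain rfl := Dart.ext_of_src_tgt hd e
    exact ⟨i, j, hij, h, rfl⟩
  · obtain rfl := Dart.ext_of_src_tgt (d' := d'.next) hd e
    exact ⟨j, 0, Nat.zero_le _, h, (gridPt_next hn d' h).symm⟩
  · obtain rfl := Dart.ext_of_src_tgt (d' := d'.prev) hd e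
    exact ⟨i, i, le_rfl, h, (gridPt_prev hn d' h).symm⟩

/-- The points of the triangulations of all wedges which lie in a given wedge are points of the
triangulation of this wedge. -/
theorem exists_gridPt_eq {d d' : Dart} {i j : ℕ} (hij : j ≤ i)
    (h : i ≤ n) (hw : d.InWedge (gridPt n d' i j)) :
    ∃ i' j', j' ≤ i' ∧ i' ≤ n ∧ gridPt n d' i j = gridPt n d i' j' := by
  by_cases hd : d.1 = d'.1
  · exact exists_gridPt_eq_of_src_eq hn hd hij h hw
  have hw' := inWedge_gridPt hn d' hij h
  have h1 : ⟪d'.src, gridPt n d' i j⟫ ≤ ⟪ico d.1, gridPt n d' i j⟫ :=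
    (hw.inner_le_tgt (Ne.symm hd)).trans hw.inner_tgt_le_src
  obtain rfl : i = n := by
    by_contra hne
    have := inner_tgt_lt_src hn d' hij (lt_of_le_of_ne h hne)
    linarith [hw'.inner_le_tgt hd]
  rcases icoNbr_cases hn d' hn hij h hd (hw'.inner_tgt_le_src.trans h1) with
    e | ⟨e, rfl⟩ | ⟨e, rfl⟩
  · have e' := gridPt_rev hn d' (Nat.sub_le i j)
    rw [Nat.sub_sub_self hij] at e'
    rw [← e'] at hw ⊢
    exact exists_gridPt_eq_of_src_eq hn e (Nat.sub_le i j) h hw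
  · have e' := gridPt_rev hn d'.next (le_refl j)
    rw [Nat.sub_self, gridPt_next hn d' h] at e'
    rw [← e'] at hw ⊢
    exact exists_gridPt_eq_of_src_eq hn e le_rfl h hw
  · have e' := gridPt_rev hn d'.prev (Nat.zero_le i)
    rw [Nat.sub_zero, gridPt_prev hn d' h] at e'
    rw [← e'] at hw ⊢
    exact exists_gridPt_eq_of_src_eq hn e (Nat.zero_le i) h hw

end

/-! ### The triangles of the polyhedron -/

theorem frame_sum {κ : Type*} (s : Finset κ) (a b : E3) (w p q r : κ → ℝ) :
    ∑ l ∈ s, w l • frame a b (p l) (q l) (r l) =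
      frame a b (∑ l ∈ s, w l * p l) (∑ l ∈ s, w l * q l) (∑ l ∈ s, w l * r l) := by
  simp only [frame, Finset.sum_div, Finset.sum_smul, ← Finset.sum_add_distrib,
    smul_add, smul_smul, mul_div_assoc]

theorem Wedge.sum {κ : Type*} {s : Finset κ} {w p q r : κ → ℝ} (hw : ∀ l ∈ s, 0 ≤ w l)
    (h : ∀ l ∈ s, Wedge (p l) (q l) (r l)) {l₀ : κ} (h0 : l₀ ∈ s) (h0' : w l₀ ≠ 0) :
    Wedge (∑ l ∈ s, w l * p l) (∑ l ∈ s, w l * q l) (∑ l ∈ s, w l * r l) := by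
  refine ⟨Finset.sum_pos' (fun l hl ↦ mul_nonneg (hw l hl) (h l hl).pos.le)
    ⟨l₀, h0, mul_pos ((hw l₀ h0).lt_of_ne' h0') (h l₀ h0).pos⟩, ?_, ?_⟩
  · refine (mul_le_mul_of_nonneg_right (Finset.abs_sum_le_sum_abs _ _) c5_pos.le).trans ?_
    rw [Finset.sum_mul, Finset.sum_mul]
    refine Finset.sum_le_sum fun l hl ↦ ?_
    rw [abs_mul, abs_of_nonneg (hw l hl), mul_assoc, mul_assoc]
    exact mul_le_mul_of_nonneg_left (h l hl).side (hw l hl)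
  · rw [Finset.mul_sum, Finset.mul_sum]
    refine Finset.sum_le_sum fun l hl ↦ ?_
    rw [mul_left_comm, mul_left_comm _ (w l)]
    exact mul_le_mul_of_nonneg_left (h l hl).far (hw l hl)

/-- A nonnegative combination, of norm `1`, of points of the wedge of a dart lies in the wedge. -/
theorem Dart.InWedge.sum {κ : Type*} {s : Finset κ} {d : Dart} {w : κ → ℝ} {x : κ → E3}
    (hw : ∀ l ∈ s, 0 ≤ w l) (h : ∀ l ∈ s, d.InWedge (x l)) (h1 : ∑ l ∈ s, w l • x l ≠ 0) :
    d.InWedge (∑ l ∈ s, w l • x l) := by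
  obtain ⟨l₀, h0, h0'⟩ := Finset.exists_ne_zero_of_sum_ne_zero h1
  choose! p q z hpqz hx using h
  rw [Finset.sum_congr rfl fun l hl ↦ by rw [← hx l hl], frame_sum]
  exact ⟨_, _, _, Wedge.sum hw hpqz h0 (left_ne_zero_of_smul h0'), rfl⟩

theorem gridInner_comm (n i j i' j' : ℕ) : gridInner n i j i' j' = gridInner n i' j' i j := by
  rw [← inner_gridPt n default, real_inner_comm, inner_gridPt]

/-- A normal vector of the plane of a row of points. -/
def rowNormal (n : ℕ) (d : Dart) (i : ℕ) : E3 :=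
  frame d.src d.tgt (-Real.sin (rowLon n i)) (Real.cos (rowLon n i)) 0

/-- A tangent vector at a point along its row. -/
def rowTangent (n : ℕ) (d : Dart) (i j : ℕ) : E3 :=
  frame d.src d.tgt (-(Real.sin (colLat n i j) * Real.cos (rowLon n i)))
    (-(Real.sin (colLat n i j) * Real.sin (rowLon n i))) (Real.cos (colLat n i j))

theorem inner_rowNormal (n : ℕ) (d : Dart) (i i' j' : ℕ) :
    ⟪rowNormal n d i, gridPt n d i' j'⟫ =
      Real.cos (colLat n i' j') * Real.sin (rowLon n i' - rowLon n i) := by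
  rw [rowNormal, gridPt, d.icoPair.inner_frame, Real.sin_sub]; ring

theorem inner_rowTangent (n : ℕ) (d : Dart) (i j j' : ℕ) :
    ⟪rowTangent n d i j, gridPt n d i j'⟫ = Real.sin (colLat n i j' - colLat n i j) := by
  rw [rowTangent, gridPt, d.icoPair.inner_frame, Real.sin_sub]
  linear_combination -(Real.sin (colLat n i j) * Real.cos (colLat n i j')) *
    Real.sin_sq_add_cos_sq (rowLon n i)

theorem vol_gridPt (n : ℕ) (d : Dart) (i j i' j' j'' : ℕ) :
    vol (gridPt n d i j) (gridPt n d i' j') (gridPt n d i' j'') =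
      Real.cos (colLat n i j) * Real.sin (rowLon n i' - rowLon n i) *
        Real.sin (colLat n i' j'' - colLat n i' j') := by
  simp only [gridPt, d.icoPair.vol_frame, Real.sin_sub]; ring

section

variable {n : ℕ} (hn : 0 < n)
include hn

theorem sin_rowLon_sub_pos {i i' : ℕ} (h : i < i') (h' : i' ≤ n) :
    0 < Real.sin (rowLon n i' - rowLon n i) := by
  have h1 := lon_lt_lon (rowAngle_nonneg hn i) (rowAngle_lt hn h) (rowAngle_le hn h')
  have h3 : 0 ≤ rowLon n i := by
    rcases Nat.eq_zero_or_pos i with rfl | h0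
    · rw [rowLon_zero]
    · have := lon_lt_lon (rowAngle_nonneg hn 0) (rowAngle_lt hn h0) (rowAngle_le hn (h.le.trans h'))
      rw [← rowLon, rowLon_zero] at this
      exact this.le
  have h4 := lon_lt_pi_div_two (rowAngle n i')
  rw [← rowLon, ← rowLon] at h1
  rw [← rowLon] at h4
  exact Real.sin_pos_of_pos_of_lt_pi (by linarith) (by linarith [Real.pi_pos])

theorem sin_rowLon_sub_neg {i i' : ℕ} (h : i' < i) (h' : i ≤ n) :
    Real.sin (rowLon n i' - rowLon n i) < 0 := by
  rw [← neg_sub, Real.sin_neg, neg_lt_zero]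
  exact sin_rowLon_sub_pos hn h h'

theorem sin_colLat_sub_pos {i j j' : ℕ} (h : j < j') (hj : j' ≤ i) (hi : i ≤ n) :
    0 < Real.sin (colLat n i j' - colLat n i j) := by
  have h1 := abs_le.1 (abs_colLat_le hn (h.le.trans hj) hi)
  have h2 := abs_le.1 (abs_colLat_le hn hj hi)
  have h3 := lat_lt_pi_div_two (rowAngle n i)
  have h4 := rowStep_pos hn (Nat.zero_lt_of_lt (h.trans_le hj)) hi
  have h5 : (j : ℝ) < j' := by exact_mod_cast h
  have h6 : colLat n i j' - colLat n i j = rowStep n i * (2 * (j' - j)) := by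
    rw [colLat, colLat]; ring
  apply Real.sin_pos_of_pos_of_lt_pi
  · rw [h6]; exact mul_pos h4 (by linarith)
  · linarith

theorem sin_colLat_sub_neg {i j j' : ℕ} (h : j' < j) (hj : j ≤ i) (hi : i ≤ n) :
    Real.sin (colLat n i j' - colLat n i j) < 0 := by
  rw [← neg_sub, Real.sin_neg, neg_lt_zero]
  exact sin_colLat_sub_pos hn h hj hi

theorem gridPt_injective (d : Dart) {i j i' j' : ℕ} (hij : j ≤ i) (h : i ≤ n) (hij' : j' ≤ i')
    (h' : i' ≤ n) (e : gridPt n d i j = gridPt n d i' j') : i = i' ∧ j = j' := by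
  have e1 := inner_rowNormal n d i i' j'
  rw [← e, inner_rowNormal, sub_self, Real.sin_zero, mul_zero, eq_comm, mul_eq_zero,
    or_iff_right (cos_colLat_pos hn hij' h').ne'] at e1
  obtain rfl : i = i' := by
    rcases lt_trichotomy i i' with hlt | rfl | hlt
    · exact absurd e1 (sin_rowLon_sub_pos hn hlt h').ne'
    · rfl
    · exact absurd e1 (sin_rowLon_sub_neg hn hlt h).ne
  have e2 := inner_rowTangent n d i j j'
  rw [← e, inner_rowTangent, sub_self, Real.sin_zero, eq_comm] at e2
  refine ⟨rfl, ?_⟩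
  rcases lt_trichotomy j j' with hlt | rfl | hlt
  · exact absurd e2 (sin_colLat_sub_pos hn hlt hij' h).ne'
  · rfl
  · exact absurd e2 (sin_colLat_sub_neg hn hlt hij h).ne

/-- A point of the triangulated wedge in the convex cone over a triangle with an edge in a row
and a vertex in a neighbouring row is a vertex of this triangle. -/
theorem gridPt_eq_of_mem_cone (d : Dart) {i a i' j j' k l : ℕ} (hadj : i' = i + 1 ∨ i = i' + 1)
    (hj : j' = j + 1) (ha : a ≤ i) (hi : i ≤ n) (hj' : j' ≤ i') (hi' : i' ≤ n)
    (hl : l ≤ k) (hk : k ≤ n) {u v w : ℝ} (hu : 0 ≤ u) (hv : 0 ≤ v) (hw : 0 ≤ w)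
    (e : gridPt n d k l = u • gridPt n d i a + v • gridPt n d i' j + w • gridPt n d i' j') :
    (k = i ∧ l = a) ∨ (k = i' ∧ (l = j ∨ l = j')) := by
  have hjj : j ≤ i' := by omega
  have c0 := cos_colLat_pos hn ha hi
  have c1 := cos_colLat_pos hn hjj hi'
  have c2 := cos_colLat_pos hn hj' hi'
  have ck := cos_colLat_pos hn hl hk
  have r1 := congrArg (inner ℝ (rowNormal n d i)) e
  have r2 := congrArg (inner ℝ (rowNormal n d i')) e
  simp only [inner_add_right, real_inner_smul_right, inner_rowNormal, sub_self, Real.sin_zero,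
    mul_zero, add_zero, zero_add] at r1 r2
  have hsum : 0 ≤ v * Real.cos (colLat n i' j) + w * Real.cos (colLat n i' j') := by positivity
  have r1' : Real.cos (colLat n k l) * Real.sin (rowLon n k - rowLon n i) =
      (v * Real.cos (colLat n i' j) + w * Real.cos (colLat n i' j')) *
        Real.sin (rowLon n i' - rowLon n i) := by rw [r1]; ring
  have r2' : Real.cos (colLat n k l) * Real.sin (rowLon n k - rowLon n i') =
      (u * Real.cos (colLat n i a)) * Real.sin (rowLon n i - rowLon n i') := by rw [r2]; ring
  have hu' : 0 ≤ u * Real.cos (colLat n i a) := by positivity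
  have hki : k = i ∨ k = i' := by
    rcases hadj with rfl | rfl
    · have s := sin_rowLon_sub_pos hn (Nat.lt_succ_self i) hi'
      have s' := sin_rowLon_sub_neg hn (Nat.lt_succ_self i) hi'
      have h1 : i ≤ k := by
        by_contra! hlt
        have := mul_neg_of_pos_of_neg ck (sin_rowLon_sub_neg hn hlt hi)
        have := mul_nonneg hsum s.le
        linarith
      have h2 : k ≤ i + 1 := by
        by_contra! hlt
        have := mul_pos ck (sin_rowLon_sub_pos hn hlt hk)
        have := mul_nonpos_of_nonneg_of_nonpos hu' s'.le
        linarith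
      omega
    · have s := sin_rowLon_sub_pos hn (Nat.lt_succ_self i') hi
      have s' := sin_rowLon_sub_neg hn (Nat.lt_succ_self i') hi
      have h1 : i' ≤ k := by
        by_contra! hlt
        have := mul_neg_of_pos_of_neg ck (sin_rowLon_sub_neg hn hlt hi')
        have := mul_nonneg hu' s.le
        linarith
      have h2 : k ≤ i' + 1 := by
        by_contra! hlt
        have := mul_pos ck (sin_rowLon_sub_pos hn hlt hk)
        have := mul_nonpos_of_nonneg_of_nonpos hsum s'.le
        linarith
      omega
  have hs : Real.sin (rowLon n i' - rowLon n i) ≠ 0 := by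
    rcases hadj with rfl | rfl
    · exact (sin_rowLon_sub_pos hn (Nat.lt_succ_self i) hi').ne'
    · exact (sin_rowLon_sub_neg hn (Nat.lt_succ_self i') hi).ne
  have hs' : Real.sin (rowLon n i - rowLon n i') ≠ 0 := by
    rw [← neg_sub, Real.sin_neg]; exact neg_ne_zero.2 hs
  rcases hki with rfl | rfl
  · left
    rw [sub_self, Real.sin_zero, mul_zero, eq_comm, mul_eq_zero, or_iff_left hs] at r1'
    obtain rfl : v = 0 := by nlinarith
    obtain rfl : w = 0 := by nlinarith
    rw [zero_smul, zero_smul, add_zero, add_zero] at e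
    have h1 := congrArg norm e
    rw [norm_smul, norm_gridPt, norm_gridPt, mul_one, Real.norm_of_nonneg hu] at h1
    rw [← h1, one_smul] at e
    exact gridPt_injective hn d hl hk ha hi e
  · right
    rw [sub_self, Real.sin_zero, mul_zero, eq_comm, mul_eq_zero, or_iff_left hs', mul_eq_zero,
      or_iff_left c0.ne'] at r2'
    subst r2' hj
    have t1 := congrArg (inner ℝ (rowTangent n d k j)) e
    have t2 := congrArg (inner ℝ (rowTangent n d k (j + 1))) e
    simp only [zero_smul, zero_add, inner_add_right, real_inner_smul_right, inner_rowTangent,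
      sub_self, Real.sin_zero, mul_zero, add_zero] at t1 t2
    have h1 : j ≤ l := by
      by_contra! hlt
      have := sin_colLat_sub_neg hn hlt hjj hk
      have := mul_nonneg hw (sin_colLat_sub_pos hn (Nat.lt_succ_self j) hj' hk).le
      linarith
    have h2 : l ≤ j + 1 := by
      by_contra! hlt
      have := sin_colLat_sub_pos hn hlt hl hk
      have := mul_nonpos_of_nonneg_of_nonpos hv
        (sin_colLat_sub_neg hn (Nat.lt_succ_self j) hj' hk).le
      linarith
    omega

end

/-- The labels of the vertices of a triangle with two vertices in the lower row. -/
def upTri (i j : ℕ) : Fin 3 → ℕ × ℕ := ![(i, j), (i + 1, j), (i + 1, j + 1)]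

/-- The labels of the vertices of a triangle with two vertices in the upper row. -/
def downTri (i j : ℕ) : Fin 3 → ℕ × ℕ := ![(i + 1, j + 1), (i, j + 1), (i, j)]

/-- The triangles of the first `n` rows, indexed by the cells of a square. -/
def cellTri (x y : ℕ) : Fin 3 → ℕ × ℕ := if y ≤ x then upTri x y else downTri y x

theorem cellTri_up {i j : ℕ} (h : j ≤ i) : cellTri i j = upTri i j := if_pos h

theorem cellTri_down {i j : ℕ} (h : j < i) : cellTri j i = downTri i j := if_neg (not_le.2 h)

theorem cellTri_induction {n : ℕ} {C : (Fin 3 → ℕ × ℕ) → Prop}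
    (up : ∀ i j, j ≤ i → i < n → C (upTri i j)) (down : ∀ i j, j < i → i < n → C (downTri i j))
    (x y : Fin n) : C (cellTri x y) := by
  rcases le_or_gt y.1 x.1 with h | h
  · rw [cellTri_up h]; exact up _ _ h x.2
  · rw [cellTri_down h]; exact down _ _ h y.2

theorem cellTri_mem {n : ℕ} (x y : Fin n) (k : Fin 3) :
    (cellTri x y k).2 ≤ (cellTri x y k).1 ∧ (cellTri x y k).1 ≤ n := by
  refine cellTri_induction (C := fun t ↦ (t k).2 ≤ (t k).1 ∧ (t k).1 ≤ n) (fun i j hj hi ↦ ?_)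
    (fun i j hj hi ↦ ?_) x y
  all_goals
    fin_cases k <;> simp [upTri, downTri] <;> omega

/-- The vertices of the triangle of the triangulated wedge at a dart. -/
def kitVert (n : ℕ) (s : Dart × Fin n × Fin n) (k : Fin 3) : E3 :=
  gridPt n s.1 (cellTri s.2.1 s.2.2 k).1 (cellTri s.2.1 s.2.2 k).2

theorem range_cellTri_injective {x y x' y' : ℕ}
    (h : Set.range (cellTri x y) = Set.range (cellTri x' y')) : x = x' ∧ y = y' := by
  have h1 : ∀ k, ∃ k', cellTri x' y' k' = cellTri x y k := fun k ↦ by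
    rw [← Set.mem_range, ← h]; exact Set.mem_range_self k
  have m0 := h1 0
  have m1 := h1 1
  have m2 := h1 2
  simp only [cellTri] at m0 m1 m2
  split_ifs at m0 m1 m2 <;>
  · simp only [Fin.exists_fin_succ, upTri, downTri, Prod.ext_iff] at m0 m1 m2
    simp at m0 m1 m2
    omega

section

variable {n : ℕ} (hn : 0 < n)
include hn

theorem vol_kitVert_pos (s : Dart × Fin n × Fin n) :
    0 < vol (kitVert n s 0) (kitVert n s 1) (kitVert n s 2) := by
  obtain ⟨d, x, y⟩ := s
  refine cellTri_induction (C := fun t ↦ 0 < vol (gridPt n d (t 0).1 (t 0).2)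
    (gridPt n d (t 1).1 (t 1).2) (gridPt n d (t 2).1 (t 2).2)) (fun i j hj hi ↦ ?_)
    (fun i j hj hi ↦ ?_) x y
  · refine (vol_gridPt n d i j (i + 1) j (j + 1)).symm ▸ mul_pos (mul_pos ?_ ?_) ?_
    · exact cos_colLat_pos hn hj hi.le
    · exact sin_rowLon_sub_pos hn (Nat.lt_succ_self i) hi
    · exact sin_colLat_sub_pos hn (Nat.lt_succ_self j) (Nat.succ_le_succ hj) hi
  · refine (vol_gridPt n d (i + 1) (j + 1) i (j + 1) j).symm ▸
      mul_pos_of_neg_of_neg (mul_neg_of_pos_of_neg ?_ ?_) ?_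
    · exact cos_colLat_pos hn (by omega) hi
    · exact sin_rowLon_sub_neg hn (Nat.lt_succ_self i) hi
    · exact sin_colLat_sub_neg hn (Nat.lt_succ_self j) hj hi.le

theorem gridInner_slant_mem {i j : ℕ} (h : i < n) (hj : j ≤ i) :
    gridInner n i j (i + 1) j ∈
      Set.Icc (1 - 2 * (s5 * Real.sin (rowGap n)) ^ 2) (Real.cos (rowGap n)) :=
  ⟨le_gridInner_slant hn h hj, gridInner_slant_le hn h hj⟩

theorem gridInner_slant_succ_mem {i j : ℕ} (h : i < n) (hj : j ≤ i) :
    gridInner n i j (i + 1) (j + 1) ∈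
      Set.Icc (1 - 2 * (s5 * Real.sin (rowGap n)) ^ 2) (Real.cos (rowGap n)) := by
  have := gridInner_mirror n hj (Nat.succ_le_succ hj)
  rw [← this, Nat.succ_eq_add_one, Nat.add_sub_add_right]
  exact gridInner_slant_mem hn h (Nat.sub_le i j)

theorem inner_kitVert_mem (s : Dart × Fin n × Fin n) {k l : Fin 3} (hkl : k ≠ l) :
    ⟪kitVert n s k, kitVert n s l⟫ ∈
      Set.Icc (1 - 2 * (s5 * Real.sin (rowGap n)) ^ 2) (Real.cos (rowGap n)) := by
  obtain ⟨d, x, y⟩ := s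
  rw [kitVert, kitVert, inner_gridPt]
  refine cellTri_induction (C := fun t ↦ gridInner n (t k).1 (t k).2 (t l).1 (t l).2 ∈
      Set.Icc (1 - 2 * (s5 * Real.sin (rowGap n)) ^ 2) (Real.cos (rowGap n)))
    (fun i j hj hi ↦ ?_) (fun i j hj hi ↦ ?_) x y
  · have h0 := gridInner_slant_mem hn hi hj
    have h1 := gridInner_slant_succ_mem hn hi hj
    have h2 : gridInner n (i + 1) j (i + 1) (j + 1) ∈ Set.Icc _ _ :=
      gridInner_row_mem hn (Nat.succ_pos i) hi j
    fin_cases k <;> fin_cases l <;>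
      first | exact absurd rfl hkl | assumption | (rw [gridInner_comm]; assumption)
  · have h0 := gridInner_slant_mem hn hi hj
    have h1 := gridInner_slant_succ_mem hn hi hj.le
    have h2 : gridInner n i j i (j + 1) ∈ Set.Icc _ _ :=
      gridInner_row_mem hn (Nat.zero_lt_of_lt hj) hi.le j
    fin_cases k <;> fin_cases l <;>
      first | exact absurd rfl hkl | assumption | (rw [gridInner_comm]; assumption)

theorem kitVert_acute (s : Dart × Fin n × Fin n) (k : Fin 3) :
    ⟪kitVert n s k, kitVert n s (k + 1)⟫ + ⟪kitVert n s k, kitVert n s (k + 2)⟫ <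
      1 + ⟪kitVert n s (k + 1), kitVert n s (k + 2)⟫ := by
  have hk : k ≠ k + 1 ∧ k ≠ k + 2 ∧ k + 1 ≠ k + 2 := by decide +revert
  have h1 := inner_kitVert_mem hn s hk.1
  have h2 := inner_kitVert_mem hn s hk.2.1
  have h3 := inner_kitVert_mem hn s hk.2.2
  linarith [long_lt_two_mul_short hn, h1.2, h2.2, h3.1]

omit hn in
theorem kitVert_up (d : Dart) {i j : ℕ} (hj : j ≤ i) (hi : i < n) (k : Fin 3) :
    kitVert n (d, ⟨i, hi⟩, ⟨j, hj.trans_lt hi⟩) k =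
      gridPt n d (upTri i j k).1 (upTri i j k).2 := by
  rw [kitVert, cellTri_up hj]

omit hn in
theorem kitVert_down (d : Dart) {i j : ℕ} (hj : j < i) (hi : i < n) (k : Fin 3) :
    kitVert n (d, ⟨j, hj.trans hi⟩, ⟨i, hi⟩) k =
      gridPt n d (downTri i j k).1 (downTri i j k).2 := by
  rw [kitVert, cellTri_down hj]

theorem kitVert_adj (s : Dart × Fin n × Fin n) (k : Fin 3) :
    ∃ s' k', kitVert n s' (k' + 1) = kitVert n s (k + 2) ∧
      kitVert n s' (k' + 2) = kitVert n s (k + 1) := by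
  obtain ⟨d, x, y⟩ := s
  refine cellTri_induction (C := fun t ↦ ∃ s' k', kitVert n s' (k' + 1) =
    gridPt n d (t (k + 2)).1 (t (k + 2)).2 ∧
      kitVert n s' (k' + 2) = gridPt n d (t (k + 1)).1 (t (k + 1)).2)
    (fun i j hj hi ↦ ?_) (fun i j hj hi ↦ ?_) x y
  · fin_cases k
    · rcases Nat.lt_or_ge (i + 1) n with h | h
      · refine ⟨_, 0, kitVert_down d (Nat.lt_succ_of_le hj) h _,
          kitVert_down d (Nat.lt_succ_of_le hj) h _⟩
      · obtain rfl : n = i + 1 := by omega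
        refine ⟨_, 0, (kitVert_up d.rev (Nat.sub_le i j) hi _).trans ?_,
          (kitVert_up d.rev (Nat.sub_le i j) hi _).trans ?_⟩
        · refine (gridPt_rev hn d (j := i - j) (by omega)).trans ?_
          rw [show i + 1 - (i - j) = j + 1 by omega]; rfl
        · refine (gridPt_rev hn d (j := i - j + 1) (by omega)).trans ?_
          rw [show i + 1 - (i - j + 1) = j by omega]; rfl
    · rcases hj.lt_or_eq with h | rfl
      · exact ⟨_, 1, kitVert_down d h hi _, kitVert_down d h hi _⟩
      · exact ⟨_, 2, (kitVert_up d.next (Nat.zero_le j) hi _).trans (gridPt_next hn d hi.le),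
          (kitVert_up d.next (Nat.zero_le j) hi _).trans (gridPt_next hn d hi)⟩
    · rcases Nat.eq_zero_or_pos j with rfl | h
      · exact ⟨_, 1, (kitVert_up d.prev le_rfl hi _).trans (gridPt_prev hn d hi),
          (kitVert_up d.prev le_rfl hi _).trans (gridPt_prev hn d hi.le)⟩
      · obtain ⟨j, rfl⟩ := Nat.exists_eq_add_of_lt h
        rw [zero_add] at *
        exact ⟨_, 2, kitVert_down d hj hi _, kitVert_down d hj hi _⟩
  · fin_cases k
    · obtain ⟨i, rfl⟩ := Nat.exists_eq_add_of_lt (Nat.zero_lt_of_lt hj)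
      rw [zero_add] at *
      exact ⟨_, 0, kitVert_up d (Nat.le_of_lt_succ hj) (Nat.lt_of_succ_lt hi) _,
        kitVert_up d (Nat.le_of_lt_succ hj) (Nat.lt_of_succ_lt hi) _⟩
    · exact ⟨_, 1, kitVert_up d hj.le hi _, kitVert_up d hj.le hi _⟩
    · exact ⟨_, 2, kitVert_up d hj hi _, kitVert_up d hj hi _⟩

theorem inWedge_kitVert (s : Dart × Fin n × Fin n) (k : Fin 3) : s.1.InWedge (kitVert n s k) :=
  inWedge_gridPt hn _ (cellTri_mem _ _ k).1 (cellTri_mem _ _ k).2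

theorem kitVert_sep (s s' : Dart × Fin n × Fin n) (k : Fin 3) (w : Fin 3 → ℝ) (hw : ∀ l, 0 ≤ w l)
    (h : kitVert n s' k = ∑ l, w l • kitVert n s l) : ∃ l, kitVert n s' k = kitVert n s l := by
  have hwedge : s.1.InWedge (kitVert n s' k) := by
    rw [h]
    refine Dart.InWedge.sum (fun l _ ↦ hw l) (fun l _ ↦ inWedge_kitVert hn s l) ?_
    rw [← h, ← norm_ne_zero_iff, kitVert, norm_gridPt]
    exact one_ne_zero
  obtain ⟨i', j', hij', hi', e⟩ := exists_gridPt_eq hn (cellTri_mem _ _ k).1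
    (cellTri_mem _ _ k).2 hwedge
  change kitVert n s' k = _ at e
  rw [e, Fin.sum_univ_three] at h
  rw [e]
  obtain ⟨d, x, y⟩ := s
  revert h
  refine cellTri_induction (C := fun t ↦ gridPt n d i' j' = w 0 • gridPt n d (t 0).1 (t 0).2 +
    w 1 • gridPt n d (t 1).1 (t 1).2 + w 2 • gridPt n d (t 2).1 (t 2).2 →
      ∃ l, gridPt n d i' j' = gridPt n d (t l).1 (t l).2)
    (fun i j hj hi h ↦ ?_) (fun i j hj hi h ↦ ?_) x y
  · rcases gridPt_eq_of_mem_cone hn d (Or.inl rfl) rfl hj hi.le (Nat.succ_le_succ hj) hi hij' hi'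
      (hw 0) (hw 1) (hw 2) h with ⟨rfl, rfl⟩ | ⟨rfl, rfl | rfl⟩
    exacts [⟨0, rfl⟩, ⟨1, rfl⟩, ⟨2, rfl⟩]
  · rcases gridPt_eq_of_mem_cone hn d (Or.inr rfl) rfl (Nat.succ_le_succ hj.le) hi hj hi.le hij' hi'
      (hw 0) (hw 2) (hw 1) (h.trans (add_right_comm _ _ _)) with ⟨rfl, rfl⟩ | ⟨rfl, rfl | rfl⟩
    exacts [⟨0, rfl⟩, ⟨2, rfl⟩, ⟨1, rfl⟩]

end

theorem Dart.icoNbr_next_ne_prev :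
    ∀ d : Dart, icoNbr d.next.1 d.next.2 ≠ icoNbr d.prev.1 d.prev.2 := by
  decide +kernel

theorem dist_eq_of_norm_eq_one {x y : E3} (hx : ‖x‖ = 1) (hy : ‖y‖ = 1) :
    dist x y = √(2 * (1 - ⟪x, y⟫)) := by
  rw [dist_eq_norm, ← Real.sqrt_sq (norm_nonneg (x - y)), norm_sub_sq_real, hx, hy]
  congr 1
  ring

section

variable {n : ℕ} (hn : 0 < n)
include hn

theorem exists_inner_tgt_lt_src (d : Dart) (x y : Fin n) :
    ∃ k, ⟪d.tgt, kitVert n (d, x, y) k⟫ < ⟪d.src, kitVert n (d, x, y) k⟫ := by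
  refine cellTri_induction (C := fun t ↦ ∃ k, ⟪d.tgt, gridPt n d (t k).1 (t k).2⟫ <
    ⟪d.src, gridPt n d (t k).1 (t k).2⟫) (fun i j hj hi ↦ ?_) (fun i j hj hi ↦ ?_) x y
  · exact ⟨0, inner_tgt_lt_src hn d hj hi⟩
  · exact ⟨2, inner_tgt_lt_src hn d hj.le hi⟩

theorem inner_lt_inner_tgt (d : Dart) {i j : ℕ} (hj : j < i) (hi : i ≤ n) {l : Fin 12}
    (hl : l ≠ d.1) (hl' : l ≠ icoNbr d.1 d.2) :
    ⟪ico l, gridPt n d i j⟫ < ⟪d.tgt, gridPt n d i j⟫ ∨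
      ⟪ico l, gridPt n d i (j + 1)⟫ < ⟪d.tgt, gridPt n d i (j + 1)⟫ := by
  by_contra! h
  have h0 := Nat.zero_lt_of_lt hj
  have hne : icoNbr d.next.1 d.next.2 ≠ icoNbr d.prev.1 d.prev.2 :=
    Dart.icoNbr_next_ne_prev d
  rcases icoNbr_cases hn d h0 hj.le hi hl h.1 with e | ⟨-, e⟩ | ⟨e, -⟩
  · exact hl' e
  · exact hj.ne e
  rcases icoNbr_cases hn d h0 hj hi hl h.2 with e' | ⟨e', -⟩ | ⟨-, e'⟩
  · exact hl' e'
  · exact hne (e'.symm.trans e)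
  · exact Nat.succ_ne_zero j e'

theorem exists_inner_lt_inner_tgt (d : Dart) (x y : Fin n) {l : Fin 12} (hl : l ≠ d.1)
    (hl' : l ≠ icoNbr d.1 d.2) :
    ∃ k, ⟪ico l, kitVert n (d, x, y) k⟫ < ⟪d.tgt, kitVert n (d, x, y) k⟫ := by
  refine cellTri_induction (C := fun t ↦ ∃ k, ⟪ico l, gridPt n d (t k).1 (t k).2⟫ <
    ⟪d.tgt, gridPt n d (t k).1 (t k).2⟫) (fun i j hj hi ↦ ?_) (fun i j hj hi ↦ ?_) x y
  · rcases inner_lt_inner_tgt hn d (Nat.lt_succ_of_le hj) hi hl hl' with h | h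
    exacts [⟨1, h⟩, ⟨2, h⟩]
  · rcases inner_lt_inner_tgt hn d hj hi.le hl hl' with h | h
    exacts [⟨2, h⟩, ⟨1, h⟩]

theorem kitVert_range_injective {s s' : Dart × Fin n × Fin n}
    (h : Set.range (kitVert n s) = Set.range (kitVert n s')) : s = s' := by
  obtain ⟨d, x, y⟩ := s
  obtain ⟨d', x', y'⟩ := s'
  have key : ∀ k, ∃ k', kitVert n (d', x', y') k' = kitVert n (d, x, y) k := fun k ↦ by
    rw [← Set.mem_range, ← h]; exact Set.mem_range_self k
  have hw : ∀ k, d'.InWedge (kitVert n (d, x, y) k) := fun k ↦ by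
    obtain ⟨k', e⟩ := key k
    exact e ▸ inWedge_kitVert hn (d', x', y') k'
  have hw' := inWedge_kitVert hn (d, x, y)
  have hsrc : d.1 = d'.1 := by
    by_contra hne
    obtain ⟨k, hk⟩ := exists_inner_tgt_lt_src hn d x y
    have h1 := (hw' k).inner_le_tgt (Ne.symm hne)
    have h2 := ((hw k).inner_le_tgt hne).trans (hw k).inner_tgt_le_src
    exact (h1.trans_lt hk).not_ge h2
  have htgt : icoNbr d'.1 d'.2 = icoNbr d.1 d.2 := by
    by_contra hne
    obtain ⟨k, hk⟩ := exists_inner_lt_inner_tgt hn d x y (hsrc ▸ Dart.icoNbr_ne d') hne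
    exact hk.not_ge ((hw k).inner_le_tgt (hsrc ▸ Dart.icoNbr_ne d))
  obtain rfl := Dart.ext_of_src_tgt hsrc htgt.symm
  have hrange : Set.range (cellTri x y) = Set.range (cellTri x' y') := by
    have hsub : ∀ {x y x' y' : Fin n}, Set.range (kitVert n (d, x, y)) ⊆
        Set.range (kitVert n (d, x', y')) → Set.range (cellTri x y) ⊆ Set.range (cellTri x' y') := by
      rintro x y x' y' hs _ ⟨k, rfl⟩
      obtain ⟨k', e⟩ := hs (Set.mem_range_self k)
      have := gridPt_injective hn d (cellTri_mem x' y' k').1 (cellTri_mem x' y' k').2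
        (cellTri_mem x y k).1 (cellTri_mem x y k).2 e
      exact ⟨k', Prod.ext this.1 this.2⟩
    exact (hsub h.subset).antisymm (hsub h.superset)
  obtain ⟨hx, hy⟩ := range_cellTri_injective hrange
  rw [Fin.ext hx, Fin.ext hy]

/-- The triangulation whose hull is a Kitrick polyhedron. -/
def kitTriangulation : AcuteTriangulation (Dart × Fin n × Fin n) where
  vert := kitVert n
  norm_vert _ _ := norm_gridPt _ _ _ _
  vol_pos := vol_kitVert_pos hn
  acute := kitVert_acute hn
  adj := kitVert_adj hn
  sep := kitVert_sep hn

theorem eq_zero_of_gridPt_eq_ico (d : Dart) {i j : ℕ} (hij : j ≤ i) (hi : i ≤ n) {l : Fin 12}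
    (h : gridPt n d i j = ico l) : l = d.1 ∧ i = 0 := by
  have hw := inWedge_gridPt hn d hij hi
  have h1 : ∀ {z : E3}, ⟪z, z⟫ = 1 → 1 ≤ ⟪z, gridPt n d i j⟫ → z = gridPt n d i j := by
    intro z hz hle
    rw [real_inner_self_eq_norm_sq, pow_eq_one_iff_of_nonneg (norm_nonneg _) two_ne_zero] at hz
    refine (inner_eq_one_iff_of_norm_eq_one hz (norm_gridPt _ _ _ _)).1 (hle.antisymm' ?_)
    have := real_inner_le_norm z (gridPt n d i j)
    rwa [hz, norm_gridPt, one_mul] at this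
  have hl : ⟪ico l, gridPt n d i j⟫ = 1 := by
    rw [← h, real_inner_self_eq_norm_sq, norm_gridPt, one_pow]
  have hld : l = d.1 := by
    by_contra hne
    have h2 := hl.ge.trans (hw.inner_le_tgt hne)
    have h3 := (h1 d.icoPair.left (h2.trans hw.inner_tgt_le_src)).trans
      (h1 d.icoPair.right h2).symm
    have h4 := d.icoPair.inner
    rw [h3, d.icoPair.right] at h4
    linarith [icoCos_lt_half]
  subst hld
  exact ⟨rfl, (gridPt_injective hn d hij hi le_rfl hn.le (h.trans (gridPt_zero n d).symm)).1⟩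

theorem gridPt_one_injective (k : Fin 12) :
    Function.Injective fun r : Fin 5 ↦ gridPt n (k, r) 1 0 := by
  intro r r' e
  have key : ∀ {r r' : Fin 5}, gridPt n (k, r) 1 0 = gridPt n (k, r') 1 0 →
      r' = r ∨ r' = r + 4 := by
    intro r r' e
    have hw := inWedge_gridPt hn (k, r') zero_le_one hn
    rw [← e] at hw
    rcases icoNbr_cases hn (k, r) one_pos zero_le_one hn (Dart.icoNbr_ne (k, r'))
      (hw.inner_le_tgt (Dart.icoNbr_ne (k, r))) with h | ⟨-, h⟩ | ⟨h, -⟩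
    · exact Or.inl (Dart.icoNbr_injective _ _ _ h)
    · exact absurd h zero_ne_one
    · exact Or.inr (Dart.icoNbr_injective _ _ _ h)
  have h1 := key e
  have h2 := key e.symm
  clear e key
  revert r r'
  decide

theorem isFaceDim_one_src_iff [NeZero n] (k : Fin 12) (q : E3) :
    IsFaceDim (kitTriangulation hn).hull (segment ℝ (ico k) q) 1 ↔
      ∃ r : Fin 5, gridPt n (k, r) 1 0 = q := by
  rw [(kitTriangulation hn).isFaceDim_one_iff]
  constructor
  · rintro ⟨⟨d, x, y⟩, a, b, hab, ha, hb⟩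
    change kitVert n (d, x, y) a = _ at ha
    change kitVert n (d, x, y) b = _ at hb
    obtain ⟨rfl, h0⟩ := eq_zero_of_gridPt_eq_ico hn d (cellTri_mem x y a).1 (cellTri_mem x y a).2 ha
    revert h0 hb
    refine cellTri_induction (C := fun t ↦ gridPt n d (t b).1 (t b).2 = q → (t a).1 = 0 →
      ∃ r, gridPt n (d.1, r) 1 0 = q) (fun i j hj hi hb h0 ↦ ?_) (fun i j hj hi hb h0 ↦ ?_) x y
    · have hi0 : a = 0 ∧ i = 0 := by
        fin_cases a <;> simp [upTri] at h0 ⊢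
        exact h0
      obtain ⟨rfl, rfl⟩ := hi0
      obtain rfl : j = 0 := by omega
      fin_cases b
      · exact absurd rfl hab
      · exact ⟨d.2, hb⟩
      · exact ⟨d.2 + 1, (gridPt_next hn d hn).trans hb⟩
    · fin_cases a <;> simp [downTri] at h0 <;> omega
  · rintro ⟨r, rfl⟩
    exact ⟨_, 0, 1, by decide, (kitVert_up (k, r) le_rfl hn 0).trans (gridPt_zero n _),
      kitVert_up (k, r) le_rfl hn 1⟩

theorem short_eq : √(2 * (1 - Real.cos (rowGap n))) = 2 * Real.sin (rowGap n / 2) := by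
  have h0 := rowGap_pos hn
  have h1 := rowGap_le hn
  have h2 := Real.sin_pos_of_pos_of_lt_pi (half_pos h0) (by linarith [Real.pi_gt_three])
  have h3 := Real.cos_sq' (rowGap n / 2)
  have h4 := Real.cos_two_mul (rowGap n / 2)
  rw [mul_div_cancel₀ _ two_ne_zero] at h4
  rw [h4, h3, ← Real.sqrt_sq (mul_pos two_pos h2).le]
  congr 1
  ring

theorem long_eq : √(2 * (2 * (s5 * Real.sin (rowGap n)) ^ 2)) = 2 * (s5 * Real.sin (rowGap n)) := by
  have h0 := rowGap_pos hn
  have h1 := rowGap_le hn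
  have h2 := Real.sin_pos_of_pos_of_lt_pi h0 (by linarith [Real.pi_gt_three])
  rw [← mul_assoc, ← sq, ← mul_pow, Real.sqrt_sq (mul_pos two_pos (mul_pos s5_pos h2)).le]

theorem dist_pole (d : Dart) :
    dist (gridPt n d 0 0) (gridPt n d 1 0) = 2 * Real.sin (rowGap n / 2) := by
  rw [dist_eq_of_norm_eq_one (norm_gridPt _ _ _ _) (norm_gridPt _ _ _ _), inner_gridPt,
    (gridInner_left hn hn : gridInner n 0 0 1 0 = _), short_eq hn]

theorem dist_base (d : Dart) :
    dist (gridPt n d 1 0) (gridPt n d 1 1) = 2 * (s5 * Real.sin (rowGap n)) := by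
  rw [dist_eq_of_norm_eq_one (norm_gridPt _ _ _ _) (norm_gridPt _ _ _ _), inner_gridPt,
    gridInner_base n 0, sub_sub_cancel, long_eq hn]

variable [NeZero n]

theorem isLeast_edgeLengths : IsLeast (edgeLengths (kitTriangulation hn).verts)
    (2 * Real.sin (rowGap n / 2)) := by
  constructor
  · rw [AcuteTriangulation.mem_edgeLengths_iff]
    exact ⟨_, 0, 1, by decide, ((congrArg₂ dist (kitVert_up default le_rfl hn 0)
      (kitVert_up default le_rfl hn 1)).trans (dist_pole hn default)).symm⟩
  · intro x hx
    rw [AcuteTriangulation.mem_edgeLengths_iff] at hx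
    obtain ⟨s, k, l, hkl, rfl⟩ := hx
    have := (inner_kitVert_mem hn s hkl).2
    rw [kitVert, kitVert] at this
    rw [← short_eq hn]
    refine (Real.sqrt_le_sqrt ?_).trans_eq (dist_eq_of_norm_eq_one (norm_gridPt _ _ _ _) (norm_gridPt _ _ _ _)).symm
    linarith

theorem isGreatest_edgeLengths : IsGreatest (edgeLengths (kitTriangulation hn).verts)
    (2 * (s5 * Real.sin (rowGap n))) := by
  constructor
  · rw [AcuteTriangulation.mem_edgeLengths_iff]
    exact ⟨_, 1, 2, by decide, ((congrArg₂ dist (kitVert_up default le_rfl hn 1)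
      (kitVert_up default le_rfl hn 2)).trans (dist_base hn default)).symm⟩
  · intro x hx
    rw [AcuteTriangulation.mem_edgeLengths_iff] at hx
    obtain ⟨s, k, l, hkl, rfl⟩ := hx
    have := (inner_kitVert_mem hn s hkl).1
    rw [kitVert, kitVert] at this
    rw [← long_eq hn]
    refine (dist_eq_of_norm_eq_one (norm_gridPt _ _ _ _) (norm_gridPt _ _ _ _)).trans_le (Real.sqrt_le_sqrt ?_)
    linarith

theorem eta_kitTriangulation : eta (kitTriangulation hn).verts =
    2 * s5 * Real.cos (kitAngle / (2 * n)) := by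
  have h0 := rowGap_pos hn
  have h2 := Real.sin_pos_of_pos_of_lt_pi (half_pos h0)
    (by linarith [rowGap_le hn, Real.pi_gt_three])
  have h3 := Real.sin_two_mul (rowGap n / 2)
  rw [mul_div_cancel₀ _ two_ne_zero] at h3
  rw [eta, (isGreatest_edgeLengths hn).csSup_eq, (isLeast_edgeLengths hn).csInf_eq, h3,
    div_eq_iff (mul_pos two_pos h2).ne', mul_comm 2 (n : ℝ), ← div_div, ← rowGap]
  ring

end

theorem InscribedTriPoly.eta_nonneg {m : ℕ} (P : InscribedTriPoly m) : 0 ≤ eta P.V := by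
  have h : ∀ x ∈ edgeLengths P.V, 0 ≤ x := by
    rintro x ⟨p, q, -, -, rfl⟩
    exact dist_nonneg
  exact div_nonneg (Real.sSup_nonneg h) (Real.sInf_nonneg h)

/-- For every positive integer `n` there is a convex polyhedron (a Kitrick polyhedron)
inscribed in the unit sphere with exactly `60 n²` triangular faces, whose ratio
`η` of longest to shortest edge equals `2 sin 36° · cos(c/(2n))` with
`c = arccos(cot 36° / √3)`; moreover its longest edges are the bases and its shortest
edges the equal legs of certain isosceles triangular faces adjacent to vertices of
valence 5.  In particular `e_{60n²} ≤ 2 sin 36° cos(c/(2n)) < 2 sin 36°`. -/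
theorem kitrick_polyhedra (n : ℕ) (hn : 0 < n) :
    ∃ P : InscribedTriPoly (60 * n ^ 2),
      eta P.V = 2 * Real.sin (π / 5) *
        Real.cos (Real.arccos (Real.cos (π / 5) / Real.sin (π / 5) / Real.sqrt 3) / (2 * n)) ∧
      (∃ a b c : E3, a ∈ P.V ∧ b ∈ P.V ∧ c ∈ P.V ∧
        IsFaceDim (convexHull ℝ (P.V : Set E3)) (convexHull ℝ ({a, b, c} : Set E3)) 2 ∧
        dist a b = dist a c ∧
        dist a b = sInf (edgeLengths P.V) ∧
        dist b c = sSup (edgeLengths P.V) ∧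
        {q : E3 | IsFaceDim (convexHull ℝ (P.V : Set E3)) (segment ℝ a q) 1}.ncard = 5) ∧
      e (60 * n ^ 2) ≤ 2 * Real.sin (π / 5) *
        Real.cos (Real.arccos (Real.cos (π / 5) / Real.sin (π / 5) / Real.sqrt 3) / (2 * n)) ∧
      2 * Real.sin (π / 5) *
        Real.cos (Real.arccos (Real.cos (π / 5) / Real.sin (π / 5) / Real.sqrt 3) / (2 * n)) <
        2 * Real.sin (π / 5) := by
  have : NeZero n := ⟨hn.ne'⟩
  let T := kitTriangulation hn
  let P : InscribedTriPoly (60 * n ^ 2) := T.toPoly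
    (by simp only [Fintype.card_prod, Fintype.card_fin]; ring)
    (fun _ _ h ↦ kitVert_range_injective hn h)
  have heta : eta P.V = 2 * s5 * Real.cos (kitAngle / (2 * n)) := eta_kitTriangulation hn
  let d : Dart := default
  let s : Dart × Fin n × Fin n := (d, ⟨0, hn⟩, ⟨0, hn⟩)
  have v0 : T.vert s 0 = gridPt n d 0 0 := kitVert_up d le_rfl hn 0
  have v1 : T.vert s 1 = gridPt n d 1 0 := kitVert_up d le_rfl hn 1
  have v2 : T.vert s 2 = gridPt n d 1 1 := kitVert_up d le_rfl hn 2
  refine ⟨P, heta, ⟨T.vert s 0, T.vert s 1, T.vert s 2, T.vert_mem_verts s 0, T.vert_mem_verts s 1,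
    T.vert_mem_verts s 2, T.isFaceDim_two_iff.2 ⟨s, T.face_univ s⟩, ?_, ?_, ?_, ?_⟩, ?_, ?_⟩
  · rw [v0, v1, v2, dist_pole hn, ← gridPt_next hn d hn, gridPt_zero,
      show d.src = d.next.src from rfl, ← gridPt_zero n, dist_pole hn]
  · rw [v0, v1, dist_pole hn]
    exact (isLeast_edgeLengths hn).csInf_eq.symm
  · rw [v1, v2, dist_base hn]
    exact (isGreatest_edgeLengths hn).csSup_eq.symm
  · have h : {q : E3 | IsFaceDim (convexHull ℝ (P.V : Set E3)) (segment ℝ (T.vert s 0) q) 1} =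
        Set.range fun r : Fin 5 ↦ gridPt n (d.1, r) 1 0 := by
      ext q
      rw [v0, gridPt_zero]
      exact isFaceDim_one_src_iff hn d.1 q
    rw [h, ← Set.image_univ, Set.ncard_image_of_injective _ (gridPt_one_injective hn d.1),
      Set.ncard_univ, Nat.card_fin]
  · have hb : BddBelow {x : ℝ | ∃ Q : InscribedTriPoly (60 * n ^ 2), x = eta Q.V} := by
      refine ⟨0, ?_⟩
      rintro x ⟨Q, rfl⟩
      exact Q.eta_nonneg
    exact (csInf_le hb ⟨P, rfl⟩).trans_eq heta
  · have h0 := half_pos (rowGap_pos hn)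
    have h1 := rowGap_le hn
    have h2 : kitAngle / (2 * n) = rowGap n / 2 := by rw [rowGap, div_div, mul_comm]
    have h3 : Real.cos (kitAngle / (2 * n)) < 1 := by
      rw [h2, ← Real.cos_zero]
      exact Real.cos_lt_cos_of_nonneg_of_le_pi le_rfl (by linarith [Real.pi_gt_three]) h0
    exact mul_lt_of_lt_one_right (mul_pos two_pos s5_pos) h3
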